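/- (Removal of coprimality for cube-free twists.) Let s ∈ ℂ with Re(s) > 3/2 and let a, b, c, r ∈ ℤ[ω]∖{0} with a, b, c ≡ 1 (mod 3), μ(abc)² = 1, and (abc, r) = 1. Then ψ_{abc}(ab²r, s) = Δ_{abc}(s)^{−1} · ∑_{d ≡ 1 (mod 3), d ∣ a} ∑_{e ≡ 1 (mod 3), e ∣ c} μ(de) · (N(d)/N(d²e)^s) · conj(g₃(ab²r/d, d)) · g₃(ab²r/d, e) · ψ(ab²er/d, s). -/

import Mathlib

noncomputable section

open Complex

namespace CubicPaper

/-- `ω = e^{2πi/3}`. -/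
def ωc : ℂ := Complex.exp (2 * Real.pi * Complex.I / 3)

/-- The ring of Eisenstein integers `ℤ[ω]`, realized as a subring of `ℂ`. -/
def Eis : Subring ℂ := Subring.closure {ωc}

/-- `ω` as an Eisenstein integer. -/
def ωE : Eis := ⟨ωc, Subring.subset_closure (Set.mem_singleton _)⟩

/-- The ramified prime `λ = 1 + 2ω`. -/
def lam : Eis := 1 + 2 * ωE

/-- The norm `N(x) = |x|²`. -/
def Nm (x : Eis) : ℝ := Complex.normSq (x : ℂ)

/-- The norm as a natural number. -/
def NmN (x : Eis) : ℕ := ⌊Nm x⌋₊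

/-- `Rep x` : `x` is the canonical generator `λ^k c`, `c ≡ 1 (mod 3)`, of a nonzero ideal;
nonzero ideals of `ℤ[ω]` are in bijection with elements satisfying `Rep`. -/
def Rep (x : Eis) : Prop := ∃ (k : ℕ) (c : Eis), (3 : Eis) ∣ (c - 1) ∧ x = lam ^ k * c

/-- `ě(z) = e^{2πi(z + z̄)}`. -/
def eE (z : ℂ) : ℂ := Complex.exp (2 * Real.pi * Complex.I * (z + (starRingEnd ℂ) z))

/-- Characterizing axioms of the cubic residue symbol; `χ b a` denotes `(a/b)₃`
(the lower entry `b ≡ 1 (mod 3)` comes first). -/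
structure IsCubicSymbol (χ : Eis → Eis → Eis) : Prop where
  one_bot : ∀ a, χ 1 a = 1
  mul_bot : ∀ b₁ b₂ a, (3 : Eis) ∣ (b₁ - 1) → (3 : Eis) ∣ (b₂ - 1) →
    χ (b₁ * b₂) a = χ b₁ a * χ b₂ a
  prime_vals : ∀ π a, Prime π → (3 : Eis) ∣ (π - 1) →
    χ π a = 0 ∨ χ π a = 1 ∨ χ π a = ωE ∨ χ π a = ωE ^ 2
  prime_congr : ∀ π a, Prime π → (3 : Eis) ∣ (π - 1) →
    π ∣ (a ^ ((NmN π - 1) / 3) - χ π a)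
  prime_eq_zero : ∀ π a, Prime π → (3 : Eis) ∣ (π - 1) → (χ π a = 0 ↔ π ∣ a)

/-- Characterizing axioms of the Möbius function on `ℤ[ω]`. -/
structure IsMoebius (μ : Eis → ℤ) : Prop where
  isUnit : ∀ u : Eis, IsUnit u → μ u = 1
  prime_mul : ∀ p x, Prime p → ¬ p ∣ x → μ (p * x) = - μ x
  eq_zero : ∀ x : Eis, ¬ Squarefree x → μ x = 0

/-- The cubic Gauss sum `g₃(m, c) = ∑_{d mod c} χ_c(d) ě(md/c)`. -/
def g₃ (χ : Eis → Eis → Eis) (m c : Eis) : ℂ :=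
  ∑ᶠ d : Eis ⧸ Ideal.span {c}, ((χ c d.out : Eis) : ℂ) * eE (((m * d.out : Eis) : ℂ) / (c : ℂ))

/-- The normalized cubic Gauss sum `g̃₃(m, c) = N(c)^{-1/2} g₃(m, c)`. -/
def g₃n (χ : Eis → Eis → Eis) (m c : Eis) : ℂ :=
  ((Real.sqrt (Nm c) : ℂ))⁻¹ * g₃ χ m c

/-- Euler's totient on `ℤ[ω]`. -/
def phiE (b : Eis) : ℕ := Nat.card {x : Eis ⧸ Ideal.span {b} // IsUnit x}

/-- The kernel `Φ_j(y) = (1/2πi)∫_{(2)} (2π)^{-jw} y^{-w} (Γ(1/2+w)/Γ(1/2))^j dw/w`. -/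
def Φ (j : ℕ) (y : ℝ) : ℂ :=
  (1 / (2 * Real.pi)) * ∫ t : ℝ,
    (2 * Real.pi : ℂ) ^ (-((j : ℂ) * (2 + t * Complex.I))) *
    (y : ℂ) ^ (-(2 + t * Complex.I)) *
    (Complex.Gamma (1 / 2 + (2 + t * Complex.I)) / Complex.Gamma (1 / 2)) ^ j /
    (2 + t * Complex.I)

/-- `A₁(q)`, the sum appearing in the approximate functional equation for `L(1/2, χ_q)`. -/
def A₁ (χ : Eis → Eis → Eis) (q : Eis) : ℂ :=
  ∑' n : {x : Eis // Rep x},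
    ((χ q n.1 : Eis) : ℂ) * (Nm n.1 : ℂ) ^ (-(1/2 : ℂ)) *
      Φ 1 (Nm n.1 / Real.sqrt (3 * Nm q))

/-- `A₂(q)`, the double sum appearing in the approximate functional equation for
`|L(1/2, χ_q)|²`. -/
def A₂ (χ : Eis → Eis → Eis) (q : Eis) : ℂ :=
  ∑' p : {x : Eis // Rep x} × {x : Eis // Rep x},
    ((χ q p.1.1 : Eis) : ℂ) * (starRingEnd ℂ) ((χ q p.2.1 : Eis) : ℂ) *
      ((Nm p.1.1 * Nm p.2.1 : ℝ) : ℂ) ^ (-(1/2 : ℂ)) *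
      Φ 2 (Nm p.1.1 * Nm p.2.1 / (3 * Nm q))

/-- `M_Y(q) = ∑_{𝔩² ∣ q, N(𝔩) ≤ Y} μ(𝔩)` (sum over nonzero ideals `𝔩`, i.e. over
canonical generators). -/
def MY (μ : Eis → ℤ) (Y : ℝ) (q : Eis) : ℤ :=
  ∑ᶠ l ∈ {l : Eis | Rep l ∧ l ^ 2 ∣ q ∧ Nm l ≤ Y}, μ l

/-- `R_Y(q) = ∑_{𝔩² ∣ q, N(𝔩) > Y} μ(𝔩)`. -/
def RY (μ : Eis → ℤ) (Y : ℝ) (q : Eis) : ℤ :=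
  ∑ᶠ l ∈ {l : Eis | Rep l ∧ l ^ 2 ∣ q ∧ Y < Nm l}, μ l

/-- The mollifier `𝓜(q) = ∑_𝔟 λ(𝔟) √N(𝔟) χ_q(𝔟)` attached to coefficients `lm`
(supported on canonical generators of squarefree ideals coprime to 3). -/
def Moll (χ : Eis → Eis → Eis) (lm : Eis → ℂ) (q : Eis) : ℂ :=
  ∑ᶠ b : Eis, lm b * (Real.sqrt (Nm b) : ℂ) * ((χ q b : Eis) : ℂ)

/-- `𝒮_M(β; F) = ∑_{q ≡ 1 (9)} M_Y(q) β_q F(N(q)/X)`. -/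
def SM (μ : Eis → ℤ) (Y X : ℝ) (F : ℝ → ℝ) (β : Eis → ℂ) : ℂ :=
  ∑ᶠ q ∈ {q : Eis | (9 : Eis) ∣ (q - 1)}, (MY μ Y q : ℂ) * β q * (F (Nm q / X) : ℂ)

/-- `𝒮_R(|β|; F) = ∑_{q ≡ 1 (9)} |R_Y(q)| ‖β_q‖ F(N(q)/X)`. -/
def SR (μ : Eis → ℤ) (Y X : ℝ) (F : ℝ → ℝ) (β : Eis → ℂ) : ℝ :=
  ∑ᶠ q ∈ {q : Eis | (9 : Eis) ∣ (q - 1)}, |(RY μ Y q : ℝ)| * ‖β q‖ * F (Nm q / X)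

/-- A test function: Schwartz (here: smooth), compactly supported in `(1,2)`,
with `0 ≤ F ≤ 1`. -/
structure IsTestFn (F : ℝ → ℝ) : Prop where
  smooth : ContDiff ℝ (⊤ : ℕ∞) F
  supp : ∀ t, F t ≠ 0 → 1 < t ∧ t < 2
  nonneg : ∀ t, 0 ≤ F t
  le_one : ∀ t, F t ≤ 1

/-- `F̌(0) = ∫₀^∞ F(t) dt`. -/
def Fcheck0 (F : ℝ → ℝ) : ℝ := ∫ t in Set.Ioi (0:ℝ), F t

/-- `F̌'(0) = ∫₀^∞ F(t) log t dt`. -/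
def Fcheck'0 (F : ℝ → ℝ) : ℝ := ∫ t in Set.Ioi (0:ℝ), F t * Real.log t

/-- The Dedekind zeta function of `ℚ(ω)` (at real `s > 1`). -/
def zetaK (s : ℝ) : ℝ := ∑' n : {x : Eis // Rep x}, (Nm n.1) ^ (-s)

/-- Product of `f(N(𝔭))` over the prime ideals `𝔭 ∤ 3` of `ℤ[ω]`, i.e. over primes
`π ≡ 1 (mod 3)` (one in each associate class). -/
def primeProd (f : ℝ → ℝ) : ℝ :=
  ∏' π : {p : Eis // Prime p ∧ (3 : Eis) ∣ (p - 1)}, f (Nm π.1)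

/-- Product of `f(N(𝔭))` over the prime ideals `𝔭 ∤ 3` dividing `x` (a finite product). -/
def primeDivProd (f : ℝ → ℝ) (x : Eis) : ℝ :=
  ∏ᶠ π ∈ {p : Eis | Prime p ∧ (3 : Eis) ∣ (p - 1) ∧ p ∣ x}, f (Nm π)

/-- The Hecke `L`-series `∑_𝔫 χ_q(𝔫) N(𝔫)^{-s}` (convergent for `Re(s) > 1`). -/
def heckeSeries (χ : Eis → Eis → Eis) (q : Eis) (s : ℂ) : ℂ :=
  ∑' n : {x : Eis // Rep x}, ((χ q n.1 : Eis) : ℂ) * (Nm n.1 : ℂ) ^ (-s)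

/-- `L` is the (unique) entire continuation of the Hecke `L`-series of `χ_q`. -/
def IsHeckeL (χ : Eis → Eis → Eis) (q : Eis) (L : ℂ → ℂ) : Prop :=
  Differentiable ℂ L ∧ ∀ s : ℂ, 1 < s.re → L s = heckeSeries χ q s

/-- Membership in the family `F₃` of conductors of primitive cubic Hecke characters
congruent to `1 (mod 9)`. -/
def memF₃ (q : Eis) : Prop :=
  ∃ q₁ q₂ : Eis, (3 : Eis) ∣ (q₁ - 1) ∧ (3 : Eis) ∣ (q₂ - 1) ∧ Squarefree (q₁ * q₂) ∧
    NmN (q₁ * q₂ ^ 2) % 9 = 1 ∧ q = q₁ * q₂ ^ 2 ∧ (9 : Eis) ∣ (q - 1) ∧ q ≠ 1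

/-- `ψ_α(r, s) = ∑_{c ≡ 1 (3), (c, α) = 1} g₃(r, c) N(c)^{-s}`. -/
def ψa (χ : Eis → Eis → Eis) (α r : Eis) (s : ℂ) : ℂ :=
  ∑' c : {c : Eis // (3 : Eis) ∣ (c - 1) ∧ IsCoprime c α},
    g₃ χ r c.1 * (Nm c.1 : ℂ) ^ (-s)

/-- `ψ(r, s) = ∑_{c ≡ 1 (3)} g₃(r, c) N(c)^{-s}`. -/
def ψ₀ (χ : Eis → Eis → Eis) (r : Eis) (s : ℂ) : ℂ :=
  ∑' c : {c : Eis // (3 : Eis) ∣ (c - 1)}, g₃ χ r c.1 * (Nm c.1 : ℂ) ^ (-s)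

/-- `Δ_α(s) = ∏_{π ≡ 1 (3) prime, π ∣ α} (1 - N(π)^{2-3s})`. -/
def Δprod (α : Eis) (s : ℂ) : ℂ :=
  ∏ᶠ π ∈ {p : Eis | Prime p ∧ (3 : Eis) ∣ (p - 1) ∧ p ∣ α},
    (1 - (Nm π : ℂ) ^ ((2 : ℂ) - 3 * s))

/-- `Ψ` is the (unique) continuation of `ψ(r, ·)` to the strip `1 < Re(s) < 2`,
holomorphic away from `s = 4/3`. -/
def IsPsiContinuation (χ : Eis → Eis → Eis) (r : Eis) (Ψ : ℂ → ℂ) : Prop :=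
  (∀ s : ℂ, 1 < s.re → s.re < 2 → s ≠ 4/3 → DifferentiableAt ℂ Ψ s) ∧
  (∀ s : ℂ, 3/2 < s.re → s.re < 2 → Ψ s = ψ₀ χ r s)


section

lemma omc_eq : ωc = ⟨-1/2, Real.sqrt 3 / 2⟩ := by
  unfold ωc
  have : (2 * Real.pi * Complex.I / 3 : ℂ) = ((2 * Real.pi / 3 : ℝ) : ℂ) * Complex.I := by
    push_cast; ring
  rw [this, Complex.exp_mul_I, ← Complex.ofReal_cos, ← Complex.ofReal_sin]
  have h : (2 * Real.pi / 3 : ℝ) = Real.pi - Real.pi / 3 := by ring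
  rw [h, Real.cos_pi_sub, Real.sin_pi_sub, Real.cos_pi_div_three, Real.sin_pi_div_three]
  apply Complex.ext <;> simp
  norm_num

lemma omc_re : ωc.re = -1/2 := by rw [omc_eq]
lemma omc_im : ωc.im = Real.sqrt 3 / 2 := by rw [omc_eq]

lemma sq3 : Real.sqrt 3 * Real.sqrt 3 = 3 := Real.mul_self_sqrt (by norm_num)

lemma omc_sq : ωc ^ 2 = -1 - ωc := by
  have := sq3
  rw [sq]
  apply Complex.ext
  · simp [omc_re, omc_im]; nlinarith
  · simp [omc_re, omc_im]; nlinarith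

lemma omE_sq : ωE ^ 2 = -1 - ωE := by
  apply Subtype.ext; simpa [ωE] using omc_sq

lemma omE_cube : ωE ^ 3 = 1 := by
  rw [pow_succ, omE_sq]; linear_combination -omE_sq

lemma exists_coords (x : Eis) : ∃ m n : ℤ, x = m + n * ωE := by
  obtain ⟨x, hx⟩ := x
  have key : ∃ m n : ℤ, x = m + n * ωc := by
    induction hx using Subring.closure_induction with
    | mem x hx => exact ⟨0, 1, by simpa using hx⟩
    | zero => exact ⟨0, 0, by simp⟩
    | one => exact ⟨1, 0, by simp⟩
    | add x y _ _ hx hy =>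
      obtain ⟨m, n, rfl⟩ := hx; obtain ⟨p, q, rfl⟩ := hy
      exact ⟨m + p, n + q, by push_cast; ring⟩
    | neg x _ hx =>
      obtain ⟨m, n, rfl⟩ := hx
      exact ⟨-m, -n, by push_cast; ring⟩
    | mul x y _ _ hx hy =>
      obtain ⟨m, n, rfl⟩ := hx; obtain ⟨p, q, rfl⟩ := hy
      refine ⟨m * p - n * q, m * q + n * p - n * q, ?_⟩
      push_cast
      linear_combination (n * q : ℂ) * omc_sq
  obtain ⟨m, n, h⟩ := key
  exact ⟨m, n, Subtype.ext (by simpa [ωE] using h)⟩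

lemma Nm_coords (m n : ℤ) : Nm (m + n * ωE) = ((m ^ 2 - m * n + n ^ 2 : ℤ) : ℝ) := by
  have := sq3
  simp [Nm, ωE, Complex.normSq_apply, omc_re, omc_im]
  nlinarith

lemma coords_inj {m n p q : ℤ} (h : (m + n * ωE : Eis) = p + q * ωE) : m = p ∧ n = q := by
  have h' : (m + n * ωc : ℂ) = p + q * ωc := by simpa [ωE] using congrArg Subtype.val h
  have him := congrArg Complex.im h'
  have hre := congrArg Complex.re h'
  simp [omc_im, omc_re] at him hre
  have : n = q := by exact_mod_cast him
  subst this
  refine ⟨?_, rfl⟩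
  have : (m : ℝ) = p := by linarith
  exact_mod_cast this

lemma Nm_mul (x y : Eis) : Nm (x * y) = Nm x * Nm y := by simp [Nm]
lemma Nm_one : Nm 1 = 1 := by simp [Nm]
lemma Nm_pow (x : Eis) (k : ℕ) : Nm (x ^ k) = Nm x ^ k := by simp [Nm]
lemma Nm_nonneg (x : Eis) : 0 ≤ Nm x := Complex.normSq_nonneg _
lemma Nm_eq_zero {x : Eis} : Nm x = 0 ↔ x = 0 := by simp [Nm]
lemma Nm_pos {x : Eis} (h : x ≠ 0) : 0 < Nm x :=
  lt_of_le_of_ne (Nm_nonneg x) (fun h' => h (Nm_eq_zero.1 h'.symm))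

lemma NmN_cast (x : Eis) : (NmN x : ℝ) = Nm x := by
  obtain ⟨m, n, rfl⟩ := exists_coords x
  have h0 := Nm_nonneg (m + n * ωE)
  unfold NmN
  rw [Nm_coords] at *
  have h1 : 0 ≤ m ^ 2 - m * n + n ^ 2 := by exact_mod_cast h0
  obtain ⟨k, hk⟩ := Int.eq_ofNat_of_zero_le h1
  rw [hk]; simp

lemma NmN_mul (x y : Eis) : NmN (x * y) = NmN x * NmN y := by
  have : (NmN (x * y) : ℝ) = ((NmN x * NmN y : ℕ) : ℝ) := by
    push_cast; simp only [NmN_cast, Nm_mul]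
  exact_mod_cast this
lemma NmN_one : NmN 1 = 1 := by simp [NmN, Nm_one]
lemma NmN_pos {x : Eis} (h : x ≠ 0) : 0 < NmN x := by
  have := Nm_pos h; rw [← NmN_cast] at this; exact_mod_cast this
lemma one_le_Nm {x : Eis} (h : x ≠ 0) : 1 ≤ Nm x := by
  rw [← NmN_cast]; exact_mod_cast NmN_pos h
lemma Nm_le_of_dvd {x y : Eis} (h : x ∣ y) (hy : y ≠ 0) : Nm x ≤ Nm y := by
  obtain ⟨z, rfl⟩ := h
  rw [Nm_mul]
  have := one_le_Nm (right_ne_zero_of_mul hy)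
  nlinarith [Nm_nonneg x]

/-- complex conjugation on Eis -/
lemma conj_mem (x : Eis) : (starRingEnd ℂ) (x : ℂ) ∈ Eis := by
  have hw : (starRingEnd ℂ) ωc = -1 - ωc := by
    apply Complex.ext
    · simp [omc_re]; norm_num
    · simp [omc_im]
  obtain ⟨m, n, rfl⟩ := exists_coords x
  have : (starRingEnd ℂ) ((m + n * ωE : Eis) : ℂ) = ((m + n * (-1 - ωE) : Eis) : ℂ) := by
    simp [ωE, hw]
  rw [this]; exact Subtype.mem _

def cj : Eis →+* Eis where
  toFun x := ⟨(starRingEnd ℂ) (x : ℂ), conj_mem x⟩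
  map_one' := by apply Subtype.ext; simp
  map_mul' x y := by apply Subtype.ext; simp
  map_zero' := by apply Subtype.ext; simp
  map_add' x y := by apply Subtype.ext; simp

lemma cj_coe (x : Eis) : ((cj x : Eis) : ℂ) = (starRingEnd ℂ) (x : ℂ) := rfl
lemma cj_cj (x : Eis) : cj (cj x) = x := by apply Subtype.ext; simp [cj_coe]
lemma cj_om : cj ωE = ωE ^ 2 := by
  rw [omE_sq]
  apply Subtype.ext
  rw [cj_coe]
  apply Complex.ext
  · simp [ωE, omc_re]; norm_num
  · simp [ωE, omc_im]
lemma Nm_cj (x : Eis) : Nm (cj x) = Nm x := by simp [Nm, cj_coe]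
lemma NmN_cj (x : Eis) : NmN (cj x) = NmN x := by simp [NmN, Nm_cj]
lemma mul_cj (x : Eis) : x * cj x = (NmN x : Eis) := by
  apply Subtype.ext
  have : (NmN x : ℂ) = ((NmN x : ℝ) : ℂ) := by simp
  simp only [Subring.coe_mul, cj_coe, Complex.mul_conj]
  rw [SubringClass.coe_natCast, this, NmN_cast]; rfl
def cjE : Eis ≃+* Eis := RingEquiv.ofRingHom cj cj (by ext x; simp [cj_cj]) (by ext x; simp [cj_cj])
lemma cj_prime {p : Eis} (h : Prime p) : Prime (cj p) :=
  (MulEquiv.prime_iff (cjE : Eis ≃* Eis)).2 h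

lemma isUnit_Nm {u : Eis} (h : IsUnit u) : Nm u = 1 := by
  obtain ⟨v, hv⟩ := h.exists_right_inv
  have h1 : NmN u * NmN v = 1 := by rw [← NmN_mul, hv, NmN_one]
  rw [← NmN_cast, Nat.eq_one_of_mul_eq_one_right h1]; simp

/-- primary -/
def Pr (x : Eis) : Prop := (3 : Eis) ∣ (x - 1)

lemma three_dvd_coords {m n : ℤ} (h : (3 : Eis) ∣ m + n * ωE) : 3 ∣ m ∧ 3 ∣ n := by
  obtain ⟨y, hy⟩ := h
  obtain ⟨p, q, rfl⟩ := exists_coords y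
  have : (m + n * ωE : Eis) = ((3 * p : ℤ) : Eis) + ((3 * q : ℤ) : Eis) * ωE := by
    rw [hy]; push_cast; ring
  obtain ⟨h1, h2⟩ := coords_inj this
  exact ⟨⟨p, h1⟩, ⟨q, h2⟩⟩

lemma Pr_coords {m n : ℤ} (h : Pr (m + n * ωE)) : 3 ∣ m - 1 ∧ 3 ∣ n := by
  apply three_dvd_coords
  have : ((m - 1 : ℤ) : Eis) + n * ωE = m + n * ωE - 1 := by push_cast; ring
  rw [this]; exact h

lemma Pr_unit {u : Eis} (h : IsUnit u) (hp : Pr u) : u = 1 := by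
  have hN := isUnit_Nm h
  obtain ⟨m, n, rfl⟩ := exists_coords u
  rw [Nm_coords] at hN
  have hN' : m ^ 2 - m * n + n ^ 2 = 1 := by exact_mod_cast hN
  obtain ⟨⟨k, hk⟩, ⟨l, hl⟩⟩ := Pr_coords hp
  have hl0 : l = 0 := by
    by_contra hne
    have : 1 ≤ l ^ 2 := by have := sq_pos_of_ne_zero hne; omega
    have h2 : 1 ≤ n ^ 2 ∧ n ^ 2 = 9 * l ^ 2 := by subst hl; constructor <;> nlinarith
    nlinarith [sq_nonneg (2 * m - n)]
  subst hl0
  simp at hl; subst hl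
  have h1 : (m - 1) * (m + 1) = 0 := by linarith
  rcases mul_eq_zero.1 h1 with h2 | h2
  · have : m = 1 := by omega
    subst this; simp
  · omega

lemma Pr_one : Pr 1 := by simp [Pr]
lemma Pr_mul {x y : Eis} (hx : Pr x) (hy : Pr y) : Pr (x * y) := by
  have : x * y - 1 = (x - 1) * y + (y - 1) := by ring
  unfold Pr; rw [this]; exact dvd_add (hx.mul_right _) hy
lemma Pr_pow {x : Eis} (hx : Pr x) (k : ℕ) : Pr (x ^ k) := by
  induction k with
  | zero => simpa using Pr_one
  | succ k ih => rw [pow_succ]; exact Pr_mul ih hx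
lemma Pr_of_mul {x y : Eis} (hx : Pr x) (hxy : Pr (x * y)) : Pr y := by
  have : y - 1 = (x * y - 1) - (x - 1) * y := by ring
  unfold Pr; rw [this]; exact dvd_sub hxy (hx.mul_right _)
lemma Pr_cj {x : Eis} (hx : Pr x) : Pr (cj x) := by
  have := map_dvd cj hx
  have h3 : cj 3 = 3 := map_ofNat cj 3
  simpa [Pr, h3] using this
lemma three_ne : (3 : Eis) ≠ 0 := by
  intro h
  have := congrArg Subtype.val h
  simp at this
lemma three_not_unit : ¬ IsUnit (3 : Eis) := by
  intro h
  have := isUnit_Nm h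
  have h3 : Nm 3 = 9 := by
    have := Nm_coords 3 0
    norm_num at this; exact this
  rw [h3] at this; norm_num at this
lemma Pr_ne_zero {x : Eis} (hx : Pr x) : x ≠ 0 := by
  rintro rfl
  apply three_not_unit
  have : (3 : Eis) ∣ 1 := by simpa [Pr] using hx
  exact isUnit_of_dvd_one this
lemma Pr_coprime {x : Eis} (hx : Pr x) : IsCoprime x 3 := by
  obtain ⟨k, hk⟩ := hx
  exact ⟨1, -k, by linear_combination hk⟩
lemma Pr_assoc {x y : Eis} (hx : Pr x) (hy : Pr y) (h : Associated x y) : x = y := by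
  obtain ⟨u, rfl⟩ := h
  rw [Pr_unit u.isUnit (Pr_of_mul hx hy)]; simp

lemma exists_near (z : ℂ) : ∃ q : Eis, Complex.normSq (z - q) < 1 := by
  set n : ℤ := round (2 * z.im / Real.sqrt 3)
  set m : ℤ := round (z.re + n / 2)
  refine ⟨m + n * ωE, ?_⟩
  have h1 := abs_le.1 (abs_sub_round (2 * z.im / Real.sqrt 3))
  have h2 := abs_le.1 (abs_sub_round (z.re + n / 2))
  have h3 : 0 < Real.sqrt 3 := by positivity
  have hs := sq3
  have e1 : (z - ((m + n * ωE : Eis) : ℂ)).re = z.re + n / 2 - m := by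
    simp [ωE, omc_re]; ring
  have e2 : (z - ((m + n * ωE : Eis) : ℂ)).im = (2 * z.im / Real.sqrt 3 - n) * (Real.sqrt 3 / 2) := by
    simp [ωE, omc_im]; field_simp
  rw [Complex.normSq_apply, e1, e2]
  set A := z.re + n / 2 - m
  set B := 2 * z.im / Real.sqrt 3 - n
  have hA : A * A ≤ 1/4 := by nlinarith [h2.1, h2.2]
  have hB : B * B ≤ 1/4 := by nlinarith [h1.1, h1.2]
  nlinarith

instance : IsPrincipalIdealRing Eis where
  principal I := by
    by_cases hI : I = ⊥
    · exact ⟨⟨0, by simp [hI]⟩⟩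
    obtain ⟨x0, hx0, hx0'⟩ := Submodule.exists_mem_ne_zero_of_ne_bot hI
    have hex : ∃ n, ∃ x ∈ I, x ≠ 0 ∧ NmN x = n := ⟨_, x0, hx0, hx0', rfl⟩
    classical
    obtain ⟨x, hx, hx', hn⟩ := Nat.find_spec hex
    have hmin : ∀ y ∈ I, y ≠ 0 → NmN x ≤ NmN y := fun y hy hy' => by
      rw [hn]; exact Nat.find_min' hex ⟨y, hy, hy', rfl⟩
    refine ⟨⟨x, le_antisymm ?_ ?_⟩⟩
    · intro y hy
      rw [Submodule.mem_span_singleton]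
      obtain ⟨q, hq⟩ := exists_near ((y : ℂ) / x)
      have hxc : (x : ℂ) ≠ 0 := by simpa using hx'
      have hr : Nm (y - q * x) < Nm x := by
        have : ((y - q * x : Eis) : ℂ) = ((y : ℂ) / x - q) * x := by
          push_cast; field_simp
        unfold Nm
        rw [this, Complex.normSq_mul]
        have := Complex.normSq_pos.2 hxc
        nlinarith
      have hr' : NmN (y - q * x) < NmN x := by
        rw [← NmN_cast, ← NmN_cast] at hr; exact_mod_cast hr
      by_cases h0 : y - q * x = 0
      · exact ⟨q, by rw [smul_eq_mul]; linear_combination -h0⟩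
      · exact absurd (hmin _ (I.sub_mem hy (I.mul_mem_left q hx)) h0) (by omega)
    · rw [Submodule.span_singleton_le_iff_mem]; exact hx

lemma exists_primary {p : Eis} (h : Prime p) (h3 : ¬ p ∣ 3) : ∃ q, Associated p q ∧ Pr q := by
  obtain ⟨m, n, hp⟩ := exists_coords p
  have homu : IsUnit ωE := IsUnit.of_mul_eq_one (ωE ^ 2) (by rw [← omE_cube]; ring)
  have hone : ∀ u : Eis, IsUnit u → Pr (p * u) → ∃ q, Associated p q ∧ Pr q := fun u hu hq =>
    ⟨p * u, ⟨hu.unit, rfl⟩, hq⟩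
  have mk : ∀ a b k l : ℤ, a = 1 + 3 * k → b = 3 * l → Pr (a + b * ωE) := by
    rintro a b k l rfl rfl
    exact ⟨k + l * ωE, by push_cast; ring⟩
  by_cases hmn : 3 ∣ m + n
  · exfalso
    -- lam divides p
    obtain ⟨k, hk⟩ := hmn
    have hpe : p = (1 - ωE) * (k * (2 + ωE) - n) := by
      have hm : m = 3 * k - n := by omega
      rw [hp, hm]; push_cast; linear_combination (k : Eis) * omE_sq
    have h3e : (3 : Eis) = (1 - ωE) * (2 + ωE) := by linear_combination omE_sq
    rcases h.irreducible.isUnit_or_isUnit hpe with hu | hu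
    · have := isUnit_Nm hu
      have h2 := Nm_coords 1 (-1)
      have e : (((1 : ℤ) : Eis) + ((-1 : ℤ) : Eis) * ωE) = 1 - ωE := by push_cast; ring
      rw [e, this] at h2
      norm_num at h2
    · apply h3
      rw [h3e, hpe]
      apply Dvd.dvd.mul_right
      obtain ⟨v, hv⟩ := hu.exists_right_inv
      exact ⟨v, by rw [mul_assoc, hv, mul_one]⟩
  · have hm : m % 3 = 0 ∨ m % 3 = 1 ∨ m % 3 = 2 := by omega
    have hn : n % 3 = 0 ∨ n % 3 = 1 ∨ n % 3 = 2 := by omega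
    have hw := omE_sq
    rcases hm with hm | hm | hm <;> rcases hn with hn | hn | hn
    · omega
    · refine hone (ωE ^ 2) (homu.pow 2) ?_
      have : p * ωE ^ 2 = ((n - m : ℤ) : Eis) + ((-m : ℤ) : Eis) * ωE := by
        rw [hp]; push_cast; linear_combination (m : Eis) * hw + (n : Eis) * omE_cube
      rw [this]; exact mk _ _ ((n - m) / 3) ((-m) / 3) (by omega) (by omega)
    · refine hone (-ωE ^ 2) (homu.pow 2).neg ?_
      have : p * (-ωE ^ 2) = ((-(n - m) : ℤ) : Eis) + ((m : ℤ) : Eis) * ωE := by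
        rw [hp]; push_cast; linear_combination -(m : Eis) * hw - (n : Eis) * omE_cube
      rw [this]; exact mk _ _ (-(n - m) / 3) (m / 3) (by omega) (by omega)
    · refine hone 1 isUnit_one ?_
      rw [mul_one, hp]; exact mk _ _ (m / 3) (n / 3) (by omega) (by omega)
    · refine hone (-ωE) homu.neg ?_
      have : p * (-ωE) = ((n : ℤ) : Eis) + ((n - m : ℤ) : Eis) * ωE := by
        rw [hp]; push_cast; linear_combination -(n : Eis) * hw
      rw [this]; exact mk _ _ (n / 3) ((n - m) / 3) (by omega) (by omega)
    · omega
    · refine hone (-1) isUnit_one.neg ?_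
      have : p * (-1) = ((-m : ℤ) : Eis) + ((-n : ℤ) : Eis) * ωE := by
        rw [hp]; push_cast; ring
      rw [this]; exact mk _ _ (-m / 3) (-n / 3) (by omega) (by omega)
    · omega
    · refine hone (ωE) homu ?_
      have : p * (ωE) = ((-n : ℤ) : Eis) + ((m - n : ℤ) : Eis) * ωE := by
        rw [hp]; push_cast; linear_combination (n : Eis) * hw
      rw [this]; exact mk _ _ (-n / 3) ((m - n) / 3) (by omega) (by omega)


lemma Pr_prime_not_dvd_three {p n : Eis} (h : Prime p) (hn : Pr n) (hd : p ∣ n) : ¬ p ∣ 3 := by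
  intro h3
  exact h.not_unit ((Pr_coprime hn).isUnit_of_dvd' hd h3)

lemma primary_induction {P : Eis → Prop} (h1 : P 1)
    (hm : ∀ p n, Prime p → Pr p → Pr n → P n → P (p * n)) (n : Eis) (hn : Pr n) : P n := by
  induction hk : NmN n using Nat.strong_induction_on generalizing n with
  | _ k ih =>
    by_cases hu : IsUnit n
    · rw [Pr_unit hu hn]; exact h1
    · have hn0 := Pr_ne_zero hn
      obtain ⟨p, hp, hpn⟩ := WfDvdMonoid.exists_irreducible_factor hu hn0
      have hp := hp.prime
      obtain ⟨q, hpq, hq⟩ := exists_primary hp (Pr_prime_not_dvd_three hp hn hpn)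
      have hqp : Prime q := hpq.prime hp
      obtain ⟨y, rfl⟩ := hpq.symm.dvd.trans hpn
      have hy := Pr_of_mul hq hn
      refine hm q y hqp hq hy (ih _ ?_ y hy rfl)
      rw [← hk, NmN_mul]
      have h0 := NmN_pos (Pr_ne_zero hy)
      have h1 : 1 < NmN q := by
        have := NmN_pos hqp.ne_zero
        have h2 : NmN q ≠ 1 := by
          intro h
          apply hqp.not_unit
          have := mul_cj q
          rw [h] at this
          exact IsUnit.of_mul_eq_one (cj q) (by simpa using this)
        omega
      nlinarith

lemma primary_induction_coprime {P : Eis → Prop} (h1 : P 1)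
    (hpp : ∀ p k, Prime p → Pr p → P (p ^ (k + 1)))
    (hm : ∀ x y, Pr x → Pr y → IsCoprime x y → P x → P y → P (x * y)) (n : Eis) (hn : Pr n) : P n := by
  induction hk : NmN n using Nat.strong_induction_on generalizing n with
  | _ k ih =>
    by_cases hu : IsUnit n
    · rw [Pr_unit hu hn]; exact h1
    · have hn0 := Pr_ne_zero hn
      obtain ⟨p, hp, hpn⟩ := WfDvdMonoid.exists_irreducible_factor hu hn0
      have hp := hp.prime
      obtain ⟨q, hpq, hq⟩ := exists_primary hp (Pr_prime_not_dvd_three hp hn hpn)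
      have hqp : Prime q := hpq.prime hp
      have hqn := hpq.symm.dvd.trans hpn
      have hfin : FiniteMultiplicity q n := FiniteMultiplicity.of_prime_left hqp hn0
      obtain ⟨y, hy1, hy2⟩ := hfin.exists_eq_pow_mul_and_not_dvd
      have hmul : multiplicity q n ≠ 0 := by
        rw [Ne, multiplicity_eq_zero]; exact not_not.2 hqn
      obtain ⟨j, hj⟩ := Nat.exists_eq_succ_of_ne_zero hmul
      rw [hj] at hy1
      have hyP : Pr y := by rw [hy1] at hn; exact Pr_of_mul (Pr_pow hq _) hn
      rw [hy1]
      refine hm _ _ (Pr_pow hq _) hyP ?_ (hpp q j hqp hq) (ih _ ?_ y hyP rfl)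
      · exact ((Prime.coprime_iff_not_dvd hqp).2 hy2).pow_left
      · rw [← hk, hy1, NmN_mul, pow_succ, NmN_mul]
        have h0 := NmN_pos (Pr_ne_zero hyP)
        have h3 := NmN_pos (pow_ne_zero j hqp.ne_zero)
        have h1 : 1 < NmN q := by
          have := NmN_pos hqp.ne_zero
          have h2 : NmN q ≠ 1 := by
            intro h
            apply hqp.not_unit
            have := mul_cj q
            rw [h] at this
            exact IsUnit.of_mul_eq_one (cj q) (by simpa using this)
          omega
        have : 1 < NmN (q ^ j) * NmN q := by nlinarith
        nlinarith

end

section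

def coordsEquiv : (Fin 2 → ℤ) ≃ₗ[ℤ] Eis :=
  LinearEquiv.ofBijective
    { toFun := fun v => (v 0 : Eis) + v 1 * ωE
      map_add' := fun v w => by simp; ring
      map_smul' := fun k v => by simp; ring }
    ⟨fun v w h => by
      obtain ⟨h0, h1⟩ := coords_inj (by simpa using h)
      funext i; fin_cases i <;> simpa, fun x => by
      obtain ⟨m, n, rfl⟩ := exists_coords x
      exact ⟨![m, n], by simp⟩⟩

def eisBasis : Module.Basis (Fin 2) ℤ Eis := Module.Basis.ofEquivFun coordsEquiv.symm

instance : Module.Free ℤ Eis := Module.Free.of_basis eisBasis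
instance : Module.Finite ℤ Eis := Module.Finite.of_basis eisBasis

lemma coordsEquiv_apply (v : Fin 2 → ℤ) : coordsEquiv v = (v 0 : Eis) + v 1 * ωE := rfl

lemma coordsEquiv_symm (m n : ℤ) : coordsEquiv.symm (m + n * ωE) = ![m, n] := by
  rw [LinearEquiv.symm_apply_eq, coordsEquiv_apply]; simp

lemma norm_eq (x : Eis) : (Algebra.norm ℤ x).natAbs = NmN x := by
  obtain ⟨m, n, rfl⟩ := exists_coords x
  have hb0 : eisBasis 0 = 1 := by
    simp [eisBasis, coordsEquiv_apply]
  have hb1 : eisBasis 1 = ωE := by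
    simp [eisBasis, coordsEquiv_apply]
  have hr : ∀ p q : ℤ, ∀ i, eisBasis.repr (p + q * ωE) i = ![p, q] i := by
    intro p q i
    have : eisBasis.repr (p + q * ωE) i = eisBasis.equivFun (p + q * ωE) i := rfl
    rw [this]; simp [eisBasis, coordsEquiv_symm]
  have h : Algebra.norm ℤ (m + n * ωE : Eis) = m ^ 2 - m * n + n ^ 2 := by
    rw [Algebra.norm_eq_matrix_det eisBasis, Matrix.det_fin_two]
    simp only [Algebra.leftMulMatrix_eq_repr_mul, hb0, hb1]
    have e : (m + n * ωE) * ωE = ((-n : ℤ) : Eis) + ((m - n : ℤ) : Eis) * ωE := by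
      push_cast; linear_combination (n : Eis) * omE_sq
    rw [mul_one, e]; simp only [hr]
    simp; ring
  have h2 : ((NmN (m + n * ωE) : ℤ) : ℝ) = ((m ^ 2 - m * n + n ^ 2 : ℤ) : ℝ) := by
    rw [← Nm_coords, ← NmN_cast]; simp
  have h3 : (NmN (m + n * ωE) : ℤ) = m ^ 2 - m * n + n ^ 2 := by exact_mod_cast h2
  rw [h, ← h3]; simp

lemma card_quot (c : Eis) : Nat.card (Eis ⧸ Ideal.span {c}) = NmN c := by
  rw [← norm_eq, ← Ideal.absNorm_span_singleton]; rfl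

lemma finite_quot {c : Eis} (h : c ≠ 0) : Finite (Eis ⧸ Ideal.span {c}) := by
  apply Ideal.finiteQuotientOfFreeOfNeBot
  simpa using h

/-- cube roots of unity or zero -/
def Val (z : Eis) : Prop := z = 0 ∨ z = 1 ∨ z = ωE ∨ z = ωE ^ 2

lemma Val_mul {x y : Eis} (hx : Val x) (hy : Val y) : Val (x * y) := by
  have h4 : ωE ^ 2 * ωE ^ 2 = ωE := by linear_combination ωE * omE_cube
  have h3 : ωE * ωE ^ 2 = 1 := by linear_combination omE_cube
  have h3' : ωE ^ 2 * ωE = 1 := by linear_combination omE_cube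
  unfold Val at *
  rcases hx with rfl | rfl | rfl | rfl <;> rcases hy with rfl | rfl | rfl | rfl <;>
    simp [h4, h3, h3', ← sq]

lemma Val_cube {x : Eis} (hx : Val x) (h0 : x ≠ 0) : x ^ 3 = 1 := by
  have h6 : (ωE ^ 2) ^ 3 = 1 := by rw [← pow_mul, mul_comm, pow_mul, omE_cube, one_pow]
  rcases hx with rfl | rfl | rfl | rfl <;> simp_all [omE_cube]

lemma Val_cj {x : Eis} (hx : Val x) : cj x = x ^ 2 := by
  rcases hx with rfl | rfl | rfl | rfl <;> simp [cj_om]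

lemma Val_inj {p x y : Eis} (hp : Prime p) (hp3 : Pr p) (hx : Val x) (hy : Val y)
    (h : p ∣ x - y) : x = y := by
  by_contra hne
  apply Pr_prime_not_dvd_three hp hp3 dvd_rfl
  have h1 : p ∣ 1 → p ∣ 3 := fun h => h.trans (one_dvd _)
  have hw := omE_sq
  have h3 := omE_cube
  -- in each case `x - y` divides 3
  refine h.trans ?_
  rcases hx with rfl | rfl | rfl | rfl <;> rcases hy with rfl | rfl | rfl | rfl <;>
    first
    | exact absurd rfl hne
    | exact ⟨-3, by ring1⟩
    | exact ⟨3, by ring1⟩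
    | exact ⟨-3 * ωE ^ 2, by linear_combination -3 * h3⟩
    | exact ⟨3 * ωE ^ 2, by linear_combination -3 * h3⟩
    | exact ⟨-3 * ωE, by linear_combination -3 * h3⟩
    | exact ⟨3 * ωE, by linear_combination -3 * h3⟩
    | exact ⟨2 + ωE, by linear_combination hw⟩
    | exact ⟨-(2 + ωE), by linear_combination hw⟩
    | exact ⟨(1 - ωE), by linear_combination hw - (ωE) * hw⟩
    | exact ⟨-(1 - ωE), by linear_combination hw - (ωE) * hw⟩
    | exact ⟨ωE - ωE ^ 2, by linear_combination hw + (ωE - 2) * h3⟩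
    | exact ⟨-(ωE - ωE ^ 2), by linear_combination hw + (ωE - 2) * h3⟩
    | exact ⟨(1 - ωE), by linear_combination hw + (-1) * h3⟩
    | exact ⟨-(1 - ωE), by linear_combination hw + (-1) * h3⟩

end

section

variable {χ : Eis → Eis → Eis}

lemma Val_zero : Val 0 := Or.inl rfl
lemma Val_one : Val 1 := Or.inr (Or.inl rfl)

lemma chi_val (hχ : IsCubicSymbol χ) {c : Eis} (hc : Pr c) (a : Eis) : Val (χ c a) := by
  refine primary_induction (P := fun c => Val (χ c a)) ?_ ?_ c hc
  · rw [hχ.one_bot]; exact Val_one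
  · intro p n hp hpp hn ih
    rw [hχ.mul_bot _ _ _ hpp hn]
    exact Val_mul (hχ.prime_vals p a hp hpp) ih

lemma NmN_mod {p : Eis} (hp : Pr p) : NmN p % 3 = 1 := by
  have h := Pr_mul hp (Pr_cj hp)
  rw [mul_cj] at h
  have h2 : Pr (((NmN p : ℤ) : Eis) + ((0 : ℤ) : Eis) * ωE) := by simpa using h
  have := (Pr_coords h2).1
  omega

lemma NmN_prime {p : Eis} (hp : Prime p) : 1 < NmN p := by
  have := NmN_pos hp.ne_zero
  have h2 : NmN p ≠ 1 := by
    intro h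
    apply hp.not_isUnit
    have := mul_cj p
    rw [h] at this
    exact IsUnit.of_mul_eq_one (cj p) (by simpa using this)
  omega

lemma NmN_exists {p : Eis} (hp : Prime p) (hpp : Pr p) : ∃ k, NmN p = 3 * (k + 1) + 1 ∧ (NmN p - 1) / 3 = k + 1 := by
  have h1 := NmN_mod hpp
  have h2 := NmN_prime hp
  refine ⟨(NmN p - 1) / 3 - 1, ?_, ?_⟩ <;> omega

lemma chi_prime_mul (hχ : IsCubicSymbol χ) {p : Eis} (hp : Prime p) (hpp : Pr p) (a b : Eis) :
    χ p (a * b) = χ p a * χ p b := by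
  refine Val_inj hp hpp (chi_val hχ hpp _) (Val_mul (chi_val hχ hpp _) (chi_val hχ hpp _)) ?_
  obtain ⟨x, hx⟩ := hχ.prime_congr p a hp hpp
  obtain ⟨y, hy⟩ := hχ.prime_congr p b hp hpp
  obtain ⟨z, hz⟩ := hχ.prime_congr p (a * b) hp hpp
  rw [mul_pow] at hz
  set A := a ^ ((NmN p - 1) / 3)
  set B := b ^ ((NmN p - 1) / 3)
  exact ⟨-z + x * B + χ p a * y, by linear_combination -hz + B * hx + χ p a * hy⟩

lemma chi_prime_congr (hχ : IsCubicSymbol χ) {p : Eis} (hp : Prime p) (hpp : Pr p) {a b : Eis}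
    (h : p ∣ a - b) : χ p a = χ p b := by
  refine Val_inj hp hpp (chi_val hχ hpp _) (chi_val hχ hpp _) ?_
  obtain ⟨x, hx⟩ := hχ.prime_congr p a hp hpp
  obtain ⟨y, hy⟩ := hχ.prime_congr p b hp hpp
  obtain ⟨z, hz⟩ := h.trans (sub_dvd_pow_sub_pow a b ((NmN p - 1) / 3))
  exact ⟨-x + y + z, by linear_combination -hx + hy + hz⟩

lemma chi_mul (hχ : IsCubicSymbol χ) {c : Eis} (hc : Pr c) (a b : Eis) :
    χ c (a * b) = χ c a * χ c b := by
  refine primary_induction (P := fun c => χ c (a * b) = χ c a * χ c b) ?_ ?_ c hc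
  · simp [hχ.one_bot]
  · intro p n hp hpp hn ih
    simp only [hχ.mul_bot _ _ _ hpp hn, ih, chi_prime_mul hχ hp hpp]; ring

lemma chi_congr (hχ : IsCubicSymbol χ) {c : Eis} (hc : Pr c) {a b : Eis} (h : c ∣ a - b) :
    χ c a = χ c b := by
  refine primary_induction (P := fun c => c ∣ a - b → χ c a = χ c b) ?_ ?_ c hc h
  · simp [hχ.one_bot]
  · intro p n hp hpp hn ih h
    simp only [hχ.mul_bot _ _ _ hpp hn]
    rw [ih ((dvd_mul_left _ _).trans h), chi_prime_congr hχ hp hpp ((dvd_mul_right _ _).trans h)]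

lemma chi_eq_zero (hχ : IsCubicSymbol χ) {c : Eis} (hc : Pr c) (a : Eis) :
    χ c a = 0 ↔ ¬ IsCoprime c a := by
  refine primary_induction (P := fun c => χ c a = 0 ↔ ¬ IsCoprime c a) ?_ ?_ c hc
  · simp [hχ.one_bot, isCoprime_one_left]
  · intro p n hp hpp hn ih
    rw [hχ.mul_bot _ _ _ hpp hn, mul_eq_zero, ih, hχ.prime_eq_zero _ _ hp hpp,
      IsCoprime.mul_left_iff, Prime.coprime_iff_not_dvd hp]
    tauto

lemma chi_ne_zero (hχ : IsCubicSymbol χ) {c : Eis} (hc : Pr c) {a : Eis} (h : IsCoprime c a) :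
    χ c a ≠ 0 := by
  rw [Ne, chi_eq_zero hχ hc]; exact not_not.2 h

lemma chi_cube (hχ : IsCubicSymbol χ) {c : Eis} (hc : Pr c) {a : Eis} (h : IsCoprime c a) :
    χ c a ^ 3 = 1 := Val_cube (chi_val hχ hc a) (chi_ne_zero hχ hc h)

lemma chi_one (hχ : IsCubicSymbol χ) {c : Eis} (hc : Pr c) : χ c 1 = 1 := by
  have h := chi_mul hχ hc 1 1
  have h0 := chi_ne_zero hχ hc (isCoprime_one_right (x := c))
  rw [mul_one] at h
  exact (mul_right_cancel₀ h0 (by rw [← h, one_mul])).symm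

lemma chi_neg_one (hχ : IsCubicSymbol χ) {c : Eis} (hc : Pr c) : χ c (-1) = 1 := by
  have h := chi_mul hχ hc (-1) (-1)
  have h3 := chi_cube hχ hc (isCoprime_one_right.neg_right (x := c))
  have : (-1 : Eis) * (-1) = 1 := by ring
  rw [this, chi_one hχ hc] at h
  linear_combination h3 - χ c (-1) * (-h)

lemma chi_neg (hχ : IsCubicSymbol χ) {c : Eis} (hc : Pr c) (a : Eis) : χ c (-a) = χ c a := by
  have := chi_mul hχ hc (-1) a
  rwa [neg_one_mul, chi_neg_one hχ hc, one_mul] at this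

lemma chi_pow (hχ : IsCubicSymbol χ) {c : Eis} (hc : Pr c) (a : Eis) (k : ℕ) :
    χ (c ^ k) a = χ c a ^ k := by
  induction k with
  | zero => simp [hχ.one_bot]
  | succ k ih => rw [pow_succ, hχ.mul_bot _ _ _ (Pr_pow hc k) hc, ih, pow_succ]

lemma chi_pow_top (hχ : IsCubicSymbol χ) {c : Eis} (hc : Pr c) (a : Eis) (k : ℕ) :
    χ c (a ^ k) = χ c a ^ k := by
  induction k with
  | zero => simp [chi_one hχ hc]
  | succ k ih => rw [pow_succ, chi_mul hχ hc, ih, pow_succ]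

lemma chi_cj (hχ : IsCubicSymbol χ) {c : Eis} (hc : Pr c) (a : Eis) :
    χ (cj c) (cj a) = cj (χ c a) := by
  refine primary_induction (P := fun c => χ (cj c) (cj a) = cj (χ c a)) ?_ ?_ c hc
  · simp [hχ.one_bot]
  · intro p n hp hpp hn ih
    rw [hχ.mul_bot _ _ _ hpp hn, map_mul, hχ.mul_bot _ _ _ (Pr_cj hpp) (Pr_cj hn), ih, map_mul]
    congr 1
    have hv : Val (cj (χ p a)) := by
      rw [Val_cj (chi_val hχ hpp _), sq]; exact Val_mul (chi_val hχ hpp _) (chi_val hχ hpp _)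
    refine Val_inj (cj_prime hp) (Pr_cj hpp) (chi_val hχ (Pr_cj hpp) _) hv ?_
    have h1 := hχ.prime_congr _ (cj a) (cj_prime hp) (Pr_cj hpp)
    have h2 := map_dvd cj (hχ.prime_congr p a hp hpp)
    rw [map_sub, map_pow] at h2
    rw [NmN_cj] at h1
    have := dvd_sub h2 h1
    simpa using this

/-! residue fields -/
lemma span_max {p : Eis} (hp : Prime p) : (Ideal.span {p}).IsMaximal :=
  PrincipalIdealRing.isMaximal_of_irreducible hp.irreducible

lemma mk_eq_mk {c a b : Eis} : Ideal.Quotient.mk (Ideal.span {c}) a = Ideal.Quotient.mk (Ideal.span {c}) b ↔ c ∣ a - b := by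
  rw [Ideal.Quotient.eq, Ideal.mem_span_singleton]

lemma mk_out {c : Eis} (x : Eis ⧸ Ideal.span {c}) : Ideal.Quotient.mk (Ideal.span {c}) x.out = x :=
  Quotient.out_eq x

lemma out_mk (c a : Eis) : c ∣ (Ideal.Quotient.mk (Ideal.span {c}) a).out - a := by
  rw [← mk_eq_mk, mk_out]

def chiM (hχ : IsCubicSymbol χ) {p : Eis} (hp : Prime p) (hpp : Pr p) :
    MulChar (Eis ⧸ Ideal.span {p}) Eis where
  toFun x := χ p x.out
  map_one' := by
    rw [← chi_one hχ hpp]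
    exact chi_prime_congr hχ hp hpp (out_mk p 1)
  map_mul' x y := by
    obtain ⟨a, rfl⟩ := Ideal.Quotient.mk_surjective x
    obtain ⟨b, rfl⟩ := Ideal.Quotient.mk_surjective y
    rw [← map_mul, chi_prime_congr hχ hp hpp (out_mk p _), chi_prime_congr hχ hp hpp (out_mk p _),
      chi_prime_congr hχ hp hpp (out_mk p _), chi_prime_mul hχ hp hpp]
  map_nonunit' x hx := by
    haveI := span_max hp
    letI := Ideal.Quotient.field (Ideal.span {p})
    have : x = 0 := by
      by_contra h
      exact hx (IsUnit.mk0 x h)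
    rw [hχ.prime_eq_zero p _ hp hpp]
    have h := out_mk p 0
    rw [map_zero] at h
    rw [this]; simpa using h

lemma chiM_mk (hχ : IsCubicSymbol χ) {p : Eis} (hp : Prime p) (hpp : Pr p) (a : Eis) :
    chiM hχ hp hpp (Ideal.Quotient.mk _ a) = χ p a :=
  chi_prime_congr hχ hp hpp (out_mk p a)

lemma chiM_ne_one (hχ : IsCubicSymbol χ) {p : Eis} (hp : Prime p) (hpp : Pr p) :
    chiM hχ hp hpp ≠ 1 := by
  intro h
  haveI := span_max hp
  letI := Ideal.Quotient.field (Ideal.span {p})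
  haveI := finite_quot hp.ne_zero
  letI := Fintype.ofFinite (Eis ⧸ Ideal.span {p})
  obtain ⟨k, hk1, hk2⟩ := NmN_exists hp hpp
  have hcard : Fintype.card (Eis ⧸ Ideal.span {p}) = NmN p := by
    rw [← card_quot, Nat.card_eq_fintype_card]
  have hall : ∀ x : Eis ⧸ Ideal.span {p}, x ≠ 0 → x ^ (k + 1) = 1 := by
    intro x hx
    obtain ⟨a, rfl⟩ := Ideal.Quotient.mk_surjective x
    have h1 : χ p a = 1 := by
      rw [← chiM_mk hχ hp hpp, h, MulChar.one_apply (IsUnit.mk0 _ hx)]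
    have h2 := hχ.prime_congr p a hp hpp
    rw [h1, hk2, ← mk_eq_mk, map_pow, map_one] at h2
    exact h2
  obtain ⟨g, hg⟩ := IsCyclic.exists_generator (α := (Eis ⧸ Ideal.span {p})ˣ)
  have ho := orderOf_eq_card_of_forall_mem_zpowers hg
  have hd : orderOf g ∣ k + 1 := by
    rw [orderOf_dvd_iff_pow_eq_one]
    ext; push_cast; exact hall _ g.ne_zero
  rw [ho, Nat.card_units, Nat.card_eq_fintype_card, hcard] at hd
  have := Nat.le_of_dvd (by omega) hd
  omega

lemma chiM_cube (hχ : IsCubicSymbol χ) {p : Eis} (hp : Prime p) (hpp : Pr p) :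
    chiM hχ hp hpp ^ 3 = 1 := by
  refine MulChar.ext fun x => ?_
  obtain ⟨a, ha⟩ := Ideal.Quotient.mk_surjective (x : Eis ⧸ Ideal.span {p})
  rw [MulChar.pow_apply_coe, MulChar.one_apply_coe]
  have hu : chiM hχ hp hpp x ≠ 0 := (x.isUnit.map (chiM hχ hp hpp)).ne_zero
  rw [← ha, chiM_mk] at hu ⊢
  exact Val_cube (chi_val hχ hpp a) hu

lemma chiM_order (hχ : IsCubicSymbol χ) {p : Eis} (hp : Prime p) (hpp : Pr p) :
    orderOf (chiM hχ hp hpp) = 3 :=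
  orderOf_eq_prime (chiM_cube hχ hp hpp) (chiM_ne_one hχ hp hpp)

end

section

variable {χ : Eis → Eis → Eis}

lemma om_prim : IsPrimitiveRoot ωE 3 := by
  rw [← orderOf_eq_prime (p := 3) omE_cube]
  · exact IsPrimitiveRoot.orderOf _
  · intro h
    have := coords_inj (m := 0) (n := 1) (p := 1) (q := 0) (by simpa using h)
    omega

lemma jac_dvd (hχ : IsCubicSymbol χ) {p : Eis} (hp : Prime p) (hpp : Pr p)
    [Fintype (Eis ⧸ Ideal.span {p})] :
    p ∣ jacobiSum (chiM hχ hp hpp) (chiM hχ hp hpp) := by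
  haveI := span_max hp
  letI := Ideal.Quotient.field (Ideal.span {p})
  obtain ⟨k, hk1, hk2⟩ := NmN_exists hp hpp
  have hcard : Fintype.card (Eis ⧸ Ideal.span {p}) = NmN p := by
    rw [← card_quot, Nat.card_eq_fintype_card]
  rw [← Ideal.mem_span_singleton, ← Ideal.Quotient.eq_zero_iff_mem, jacobiSum, map_sum]
  have hx : ∀ x : Eis ⧸ Ideal.span {p}, Ideal.Quotient.mk (Ideal.span {p}) (chiM hχ hp hpp x) = x ^ (k + 1) := by
    intro x
    obtain ⟨a, rfl⟩ := Ideal.Quotient.mk_surjective x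
    have := hχ.prime_congr p a hp hpp
    rw [hk2, ← mk_eq_mk, map_pow] at this
    rw [chiM_mk, this]
  simp only [map_mul, hx]
  have : ∀ x : Eis ⧸ Ideal.span {p}, x ^ (k + 1) * (1 - x) ^ (k + 1) =
      ∑ j ∈ Finset.range (k + 1 + 1), x ^ (k + 1 + j) * ((-1) ^ j * ((k + 1).choose j : Eis ⧸ Ideal.span {p})) := by
    intro x
    have : (1 - x) = (-x) + 1 := by ring
    rw [this, add_pow, Finset.mul_sum]
    refine Finset.sum_congr rfl fun j _ => ?_
    rw [neg_pow x j]; ring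
  simp only [this]
  rw [Finset.sum_comm]
  refine Finset.sum_eq_zero fun j hj => ?_
  rw [← Finset.sum_mul, FiniteField.sum_pow_lt_card_sub_one, zero_mul]
  rw [Finset.mem_range] at hj
  rw [hcard]; omega

lemma chiM_sq (hχ : IsCubicSymbol χ) {p : Eis} (hp : Prime p) (hpp : Pr p) :
    (chiM hχ hp hpp)⁻¹ = (chiM hχ hp hpp).ringHomComp cj := by
  rw [inv_eq_iff_mul_eq_one]
  refine MulChar.ext fun x => ?_
  obtain ⟨a, ha⟩ := Ideal.Quotient.mk_surjective (x : Eis ⧸ Ideal.span {p})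
  have hu : chiM hχ hp hpp x ≠ 0 := (x.isUnit.map (chiM hχ hp hpp)).ne_zero
  rw [MulChar.mul_apply, MulChar.one_apply_coe, MulChar.ringHomComp_apply]
  rw [← ha, chiM_mk] at hu ⊢
  rw [Val_cj (chi_val hχ hpp a), ← Val_cube (chi_val hχ hpp a) hu]; ring

lemma jac_eq (hχ : IsCubicSymbol χ) {p : Eis} (hp : Prime p) (hpp : Pr p)
    [Fintype (Eis ⧸ Ideal.span {p})] :
    jacobiSum (chiM hχ hp hpp) (chiM hχ hp hpp) = - p := by
  haveI := span_max hp
  letI := Ideal.Quotient.field (Ideal.span {p})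
  obtain ⟨k, hk1, hk2⟩ := NmN_exists hp hpp
  have hcard : Fintype.card (Eis ⧸ Ideal.span {p}) = NmN p := by
    rw [← card_quot, Nat.card_eq_fintype_card]
  obtain ⟨y, hy⟩ := jac_dvd hχ hp hpp
  set X := chiM hχ hp hpp with hX
  have hX1 : X ≠ 1 := chiM_ne_one hχ hp hpp
  -- congruence mod 3
  obtain ⟨z, -, hz⟩ := exists_jacobiSum_eq_neg_one_add (n := 3) (by norm_num) (χ := X) (ψ := X)
    (chiM_cube hχ hp hpp) (chiM_cube hχ hp hpp) (by rw [hcard]; omega) om_prim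
  -- norm
  have hnorm : jacobiSum X X * cj (jacobiSum X X) = (NmN p : Eis) := by
    have hinj : Function.Injective (Eis.subtype) := Subtype.val_injective
    apply hinj
    rw [← jacobiSum_ringHomComp, ← chiM_sq hχ hp hpp, map_mul, ← jacobiSum_ringHomComp, ← jacobiSum_ringHomComp]
    have e : (chiM hχ hp hpp)⁻¹.ringHomComp Eis.subtype = ((chiM hχ hp hpp).ringHomComp Eis.subtype)⁻¹ := by
      rw [← MulChar.ringHomComp_inv]
    rw [e, jacobiSum_mul_jacobiSum_inv, hcard, map_natCast]
    · have hp' : (ringChar (Eis ⧸ Ideal.span {p})).Prime := CharP.char_is_prime (Eis ⧸ Ideal.span {p}) _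
      rw [ringChar.eq_zero]
      exact hp'.ne_zero.symm
    · rwa [Ne, MulChar.ringHomComp_eq_one_iff hinj]
    · rwa [Ne, MulChar.ringHomComp_eq_one_iff hinj]
    · rw [← MulChar.ringHomComp_mul, Ne, MulChar.ringHomComp_eq_one_iff hinj, ← sq]
      intro h2
      have h3 := chiM_cube hχ hp hpp
      rw [← hX, pow_succ, h2, one_mul] at h3
      exact hX1 h3
  rw [hy, mul_cj, NmN_mul] at hnorm
  have hN : NmN p * NmN y = NmN p := by
    have : ((NmN p * NmN y : ℕ) : ℂ) = (NmN p : ℂ) := by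
      simpa using congrArg Subtype.val hnorm
    exact_mod_cast this
  have hy1 : NmN y = 1 := by
    have := NmN_prime hp
    exact Nat.eq_of_mul_eq_mul_left (NmN_pos hp.ne_zero) (by rw [hN, mul_one])
  have hyu : IsUnit (-y) := by
    have := mul_cj y
    rw [hy1] at this
    exact (IsUnit.of_mul_eq_one (cj y) (by simpa using this)).neg
  have hyP : Pr (p * (-y)) := by
    refine ⟨z * ωE, ?_⟩
    rw [hz] at hy
    linear_combination hy - z * omE_sq
  have := Pr_unit hyu (Pr_of_mul hpp hyP)
  rw [hy]; linear_combination -p * this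

lemma recip_aux (hχ : IsCubicSymbol χ) {p q : Eis} (hp : Prime p) (hpp : Pr p) (hq : Prime q) (hqp : Pr q)
    (hne : ringChar (Eis ⧸ Ideal.span {q}) ≠ ringChar (Eis ⧸ Ideal.span {p}))
    (hco : ¬ q ∣ NmN p * p) :
    χ q (NmN p * p) * χ p (NmN q) = 1 := by
  haveI := span_max hp
  haveI := span_max hq
  letI := Ideal.Quotient.field (Ideal.span {p})
  letI := Ideal.Quotient.field (Ideal.span {q})
  haveI := finite_quot hp.ne_zero
  letI := Fintype.ofFinite (Eis ⧸ Ideal.span {p})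
  haveI := finite_quot hq.ne_zero
  letI := Fintype.ofFinite (Eis ⧸ Ideal.span {q})
  have hcardp : Fintype.card (Eis ⧸ Ideal.span {p}) = NmN p := by
    rw [← card_quot, Nat.card_eq_fintype_card]
  have hcardq : Fintype.card (Eis ⧸ Ideal.span {q}) = NmN q := by
    rw [← card_quot, Nat.card_eq_fintype_card]
  let Ψ := AddChar.FiniteField.primitiveChar (Eis ⧸ Ideal.span {p}) (Eis ⧸ Ideal.span {q}) hne
  let K := CyclotomicField Ψ.n (Eis ⧸ Ideal.span {q})
  let f : Eis →+* K := (algebraMap (Eis ⧸ Ideal.span {q}) K).comp (Ideal.Quotient.mk _)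
  have hf : ∀ x y, f x = f y ↔ q ∣ x - y := by
    intro x y
    rw [← mk_eq_mk]
    exact (algebraMap (Eis ⧸ Ideal.span {q}) K).injective.eq_iff
  let X := (chiM hχ hp hpp).ringHomComp f
  have hX3 : X ^ 3 = 1 := by
    change (chiM hχ hp hpp).ringHomComp f ^ 3 = 1
    rw [MulChar.ringHomComp_pow, chiM_cube, MulChar.ringHomComp_one]
  have hXne : X ≠ 1 := by
    intro h
    apply chiM_ne_one hχ hp hpp
    refine MulChar.ext fun x => ?_
    have h1 : X x = 1 := by rw [h, MulChar.one_apply_coe]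
    rw [MulChar.one_apply_coe]
    rw [MulChar.ringHomComp_apply, ← map_one f, hf] at h1
    obtain ⟨a, ha⟩ := Ideal.Quotient.mk_surjective (x : Eis ⧸ Ideal.span {p})
    rw [← ha, chiM_mk] at h1 ⊢
    exact Val_inj hq hqp (chi_val hχ hpp a) Val_one h1
  have hXo : orderOf X = 3 := orderOf_eq_prime hX3 hXne
  have hXmk : ∀ a : Eis, X (Ideal.Quotient.mk _ a) = f (χ p a) := fun a => by
    rw [MulChar.ringHomComp_apply, chiM_mk]
  set g := gaussSum X Ψ.char with hg
  have hg3 : g ^ 3 = f (-(NmN p * p)) := by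
    have := gaussSum_pow_eq_prod_jacobiSum (χ := X) (ψ := Ψ.char) (by rw [hXo]; norm_num) Ψ.prim
    rw [hXo] at this
    rw [hg, this]
    have hm : X (-1) = 1 := by
      have := hXmk (-1)
      rw [chi_neg_one hχ hpp] at this
      simpa using this
    rw [hm]
    simp only [Nat.add_one_sub_one, Nat.Ico_succ_singleton, Finset.prod_singleton, pow_one, one_mul]
    rw [jacobiSum_ringHomComp, jac_eq hχ hp hpp, hcardp, ← map_natCast f, ← map_mul]
    congr 1; ring
  have hg0 : g ≠ 0 := by
    intro h0
    rw [h0, zero_pow (by norm_num), eq_comm, ← map_zero f, hf] at hg3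
    apply hco
    simpa using hg3
  -- Frobenius
  have hfrob : X (NmN q) * g ^ (NmN q) = g := by
    obtain ⟨n, hpr, hc⟩ := FiniteField.card (Eis ⧸ Ideal.span {q}) (ringChar (Eis ⧸ Ideal.span {q}))
    set P := ringChar (Eis ⧸ Ideal.span {q})
    haveI : Fact P.Prime := ⟨hpr⟩
    haveI : CharP K P := charP_of_injective_algebraMap (algebraMap (Eis ⧸ Ideal.span {q}) K).injective P
    haveI : ExpChar K P := ExpChar.prime hpr
    have hNq : NmN q = P ^ (n : ℕ) := by rw [← hcardq, hc]
    have hu : IsUnit ((NmN q : ℕ) : Eis ⧸ Ideal.span {p}) := by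
      rw [hNq]; push_cast
      refine IsUnit.pow _ (IsUnit.mk0 _ ?_)
      intro h0
      have hd := (ringChar.spec (Eis ⧸ Ideal.span {p}) P).1 h0
      have hp' : (ringChar (Eis ⧸ Ideal.span {p})).Prime := CharP.char_is_prime (Eis ⧸ Ideal.span {p}) _
      exact hne ((Nat.prime_dvd_prime_iff_eq hp' hpr).1 hd).symm
    have e : g ^ (NmN q) = gaussSum X (AddChar.mulShift Ψ.char ((NmN q : ℕ) : Eis ⧸ Ideal.span {p})) := by
      rw [hg, gaussSum, gaussSum, hNq, sum_pow_char_pow]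
      refine Finset.sum_congr rfl fun x _ => ?_
      rw [mul_pow]
      congr 1
      · by_cases hx : IsUnit x
        · have hx3 : X x ^ 3 = 1 := by
            rw [← MulChar.pow_apply' X (by norm_num), hX3, MulChar.one_apply hx]
          have := NmN_mod hqp
          obtain ⟨j, hj⟩ : ∃ j, NmN q = 3 * j + 1 := ⟨NmN q / 3, by omega⟩
          rw [← hNq, hj, pow_succ, pow_mul, hx3, one_pow, one_mul]
        · rw [MulChar.map_nonunit X hx, zero_pow (pow_ne_zero _ hpr.ne_zero)]
      · rw [AddChar.mulShift_apply, ← AddChar.map_nsmul_eq_pow, nsmul_eq_mul]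
    rw [e]
    have := gaussSum_mulShift X Ψ.char hu.unit
    rw [IsUnit.unit_spec] at this
    exact this
  obtain ⟨k, hk1, hk2⟩ := NmN_exists hq hqp
  have h1 : X (NmN q) * f ((-(NmN p * p)) ^ (k + 1)) = 1 := by
    rw [hk1, pow_succ, pow_mul, hg3, ← map_pow, ← mul_assoc, ← hk1] at hfrob
    exact mul_right_cancel₀ hg0 (by rw [hfrob, one_mul])
  have h2 := hχ.prime_congr q (-(NmN p * p)) hq hqp
  rw [hk2, ← hf] at h2
  have h3 := hXmk (NmN q)
  rw [map_natCast] at h3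
  rw [h2, h3, ← map_mul, ← map_one f, hf, chi_neg hχ hqp] at h1
  rw [mul_comm]
  exact Val_inj hq hqp (Val_mul (chi_val hχ hpp _) (chi_val hχ hqp _)) Val_one h1

end

section

variable {χ : Eis → Eis → Eis}

lemma Pr_dvd_prime {p q : Eis} (hp : Prime p) (hpp : Pr p) (hq : Prime q) (hqp : Pr q)
    (h : q ∣ p) : q = p :=
  Pr_assoc hqp hpp (hq.associated_of_dvd hp h)

lemma dvd_NmN {p q : Eis} (hp : Prime p) (hq : Prime q)
    (h : ringChar (Eis ⧸ Ideal.span {q}) = ringChar (Eis ⧸ Ideal.span {p})) : q ∣ (NmN p : Eis) := by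
  haveI := span_max hp
  letI := Ideal.Quotient.field (Ideal.span {p})
  haveI := finite_quot hp.ne_zero
  letI := Fintype.ofFinite (Eis ⧸ Ideal.span {p})
  have hcardp : Fintype.card (Eis ⧸ Ideal.span {p}) = NmN p := by
    rw [← card_quot, Nat.card_eq_fintype_card]
  obtain ⟨n, hpr, hc⟩ := FiniteField.card (Eis ⧸ Ideal.span {p}) (ringChar (Eis ⧸ Ideal.span {p}))
  have h0 : ((ringChar (Eis ⧸ Ideal.span {q}) : ℕ) : Eis ⧸ Ideal.span {q}) = 0 := ringChar.Nat.cast_ringChar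
  rw [← map_natCast (Ideal.Quotient.mk _), Ideal.Quotient.eq_zero_iff_mem, Ideal.mem_span_singleton, h] at h0
  rw [← hcardp, hc]
  push_cast
  exact h0.trans (dvd_pow_self _ n.ne_zero)

lemma recip_diff (hχ : IsCubicSymbol χ) {p q : Eis} (hp : Prime p) (hpp : Pr p) (hq : Prime q) (hqp : Pr q)
    (h1 : p ≠ q) (h2 : q ≠ cj p) : χ q p = χ p q := by
  have key : ∀ {p q : Eis}, Prime p → Pr p → Prime q → Pr q → p ≠ q → q ≠ cj p → ¬ q ∣ (NmN p : Eis) := by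
    intro p q hp hpp hq hqp h1 h2 h
    rw [← mul_cj] at h
    rcases hq.dvd_or_dvd h with h | h
    · exact h1 (Pr_dvd_prime hp hpp hq hqp h).symm
    · exact h2 (Pr_dvd_prime (cj_prime hp) (Pr_cj hpp) hq hqp h)
  have h2' : p ≠ cj q := by
    intro h; apply h2; rw [h, cj_cj]
  have k1 := key hp hpp hq hqp h1 h2
  have k2 := key hq hqp hp hpp h1.symm h2'
  have hne : ringChar (Eis ⧸ Ideal.span {q}) ≠ ringChar (Eis ⧸ Ideal.span {p}) := fun h =>
    k1 (dvd_NmN hp hq h)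
  have A := recip_aux hχ hp hpp hq hqp hne (by
    intro h
    rcases hq.dvd_or_dvd h with h | h
    · exact k1 h
    · exact h1 (Pr_dvd_prime hp hpp hq hqp h).symm)
  have B := recip_aux hχ hq hqp hp hpp hne.symm (by
    intro h
    rcases hp.dvd_or_dvd h with h | h
    · exact k2 h
    · exact h1 (Pr_dvd_prime hq hqp hp hpp h))
  rw [chi_mul hχ hqp] at A
  rw [chi_mul hχ hpp] at B
  linear_combination (χ q p) * (- B) + (χ p q) * A

lemma recip_prime (hχ : IsCubicSymbol χ) {p q : Eis} (hp : Prime p) (hpp : Pr p) (hq : Prime q) (hqp : Pr q)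
    (h1 : p ≠ q) : χ q p = χ p q := by
  by_cases h2 : q = cj p
  swap
  · exact recip_diff hχ hp hpp hq hqp h1 h2
  have hndvd : ¬ p ∣ cj p := fun h => h1 (by rw [h2]; exact Pr_dvd_prime (cj_prime hp) (Pr_cj hpp) hp hpp h)
  have hndvd' : ¬ cj p ∣ p := fun h => hndvd (by simpa [cj_cj] using map_dvd cj h)
  -- u = -(p + cj p)
  set u : Eis := -(p + cj p) with hu
  have huP : Pr u := by
    obtain ⟨y, hy⟩ := Pr_cj hpp
    obtain ⟨x, hx⟩ := id hpp
    exact ⟨-x - y - 1, by rw [hu]; linear_combination -hx - hy⟩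
  have hucj : cj u = u := by rw [hu]; simp [cj_cj]; ring
  have hpu : ¬ p ∣ u := by
    intro h
    apply hndvd
    have : cj p = -u - p := by rw [hu]; ring
    rw [this]; exact dvd_sub (h.neg_right) dvd_rfl
  have hpu' : ¬ cj p ∣ u := by
    intro h
    apply hndvd'
    have : p = -u - cj p := by rw [hu]; ring
    have h' : cj p ∣ -u - cj p := dvd_sub h.neg_right dvd_rfl
    rwa [← this] at h'
  have hrec : ∀ n, Pr n → ¬ p ∣ n → ¬ cj p ∣ n → χ n p = χ p n := by
    intro n hn
    refine primary_induction (P := fun n => ¬ p ∣ n → ¬ cj p ∣ n → χ n p = χ p n) ?_ ?_ n hn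
    · intro _ _; rw [hχ.one_bot, chi_one hχ hpp]
    · intro r m hr hrp hm ih h1 h2
      rw [hχ.mul_bot _ _ _ hrp hm, chi_mul hχ hpp, ih (fun h => h1 (h.mul_left _)) (fun h => h2 (h.mul_left _))]
      congr 1
      refine recip_diff hχ hp hpp hr hrp ?_ ?_
      · rintro rfl; exact h1 (dvd_mul_right _ _)
      · rintro rfl; exact h2 (dvd_mul_right _ _)
  have e1 : χ p (cj p) = χ u p := by
    rw [hrec u huP hpu hpu', ← chi_neg hχ hpp u]
    exact chi_congr hχ hpp ⟨-1, by rw [hu]; ring⟩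
  have e2 : χ u p = χ u (cj p) := by
    rw [← chi_neg hχ huP (cj p)]
    exact chi_congr hχ huP ⟨-1, by rw [hu]; ring⟩
  have e3 : χ u (cj p) = cj (χ u p) := by
    conv_lhs => rw [← hucj]
    exact chi_cj hχ huP p
  have hco : IsCoprime p u := (Prime.coprime_iff_not_dvd hp).2 hpu
  have e4 : χ u p = 1 := by
    have h3 := chi_cube hχ huP hco.symm
    have h4 := e2.trans e3
    rw [Val_cj (chi_val hχ huP p)] at h4
    have h0 := chi_ne_zero hχ huP hco.symm
    exact mul_left_cancel₀ h0 (by linear_combination -h4)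
  have e5 : χ (cj p) p = cj (χ p (cj p)) := by
    have := chi_cj hχ hpp (cj p)
    rwa [cj_cj] at this
  rw [h2, e5, e1, e4, map_one]

/-- cubic reciprocity -/
lemma recip (hχ : IsCubicSymbol χ) {x y : Eis} (hx : Pr x) (hy : Pr y) (h : IsCoprime x y) :
    χ x y = χ y x := by
  revert h
  refine primary_induction (P := fun x => IsCoprime x y → χ x y = χ y x) ?_ ?_ x hx
  · intro _; rw [hχ.one_bot, chi_one hχ hy]
  · intro p n hp hpp hn ih h
    rw [IsCoprime.mul_left_iff] at h
    rw [hχ.mul_bot _ _ _ hpp hn, chi_mul hχ hy, ih h.2]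
    congr 1
    have h1 := h.1
    revert h1
    refine primary_induction (P := fun y => IsCoprime p y → χ p y = χ y p) ?_ ?_ y hy
    · intro _; rw [hχ.one_bot, chi_one hχ hpp]
    · intro q m hq hqp hm ih h
      rw [IsCoprime.mul_right_iff] at h
      rw [hχ.mul_bot _ _ _ hqp hm, chi_mul hχ hpp, ih h.2]
      congr 1
      refine recip_prime hχ hq hqp hp hpp ?_
      rintro rfl
      exact hp.not_isUnit (isCoprime_self.1 h.1)

end

section

/-- Periodicity modulo `c`. -/
def Per (c : Eis) (F : Eis → ℂ) : Prop := ∀ a b, c ∣ a - b → F a = F b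

/-- Sum over a full residue system modulo `c`. -/
def sumMod (c : Eis) (F : Eis → ℂ) : ℂ := ∑ᶠ d : Eis ⧸ Ideal.span {c}, F d.out

lemma sumMod_eq_sum (c : Eis) [Fintype (Eis ⧸ Ideal.span {c})] (F : Eis → ℂ) :
    sumMod c F = ∑ d : Eis ⧸ Ideal.span {c}, F d.out := finsum_eq_sum_of_fintype _

lemma sumMod_of_bij {c : Eis} {F : Eis → ℂ} (hF : Per c F) {ι : Type*} (φ : ι → Eis)
    (hφ : Function.Bijective (fun i => Ideal.Quotient.mk (Ideal.span {c}) (φ i))) :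
    sumMod c F = ∑ᶠ i, F (φ i) := by
  unfold sumMod
  rw [← finsum_comp_equiv (Equiv.ofBijective _ hφ)]
  apply finsum_congr
  intro i
  exact hF _ _ (out_mk c (φ i))

lemma sumMod_congr {c : Eis} {F G : Eis → ℂ} (h : ∀ d, F d = G d) : sumMod c F = sumMod c G := by
  unfold sumMod; exact finsum_congr (fun i => h _)

lemma sumMod_mul_left {c : Eis} (hc : c ≠ 0) (F : Eis → ℂ) (z : ℂ) :
    sumMod c (fun d => z * F d) = z * sumMod c F := by
  haveI := finite_quot hc
  letI := Fintype.ofFinite (Eis ⧸ Ideal.span {c})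
  rw [sumMod_eq_sum, sumMod_eq_sum, Finset.mul_sum]

lemma sumMod_conj {c : Eis} (hc : c ≠ 0) (F : Eis → ℂ) :
    sumMod c (fun d => (starRingEnd ℂ) (F d)) = (starRingEnd ℂ) (sumMod c F) := by
  haveI := finite_quot hc
  letI := Fintype.ofFinite (Eis ⧸ Ideal.span {c})
  rw [sumMod_eq_sum, sumMod_eq_sum, map_sum]

lemma sumMod_comm {c d : Eis} (hc : c ≠ 0) (hd : d ≠ 0) (F : Eis → Eis → ℂ) :
    sumMod c (fun x => sumMod d (fun y => F x y)) = sumMod d (fun y => sumMod c (fun x => F x y)) := by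
  haveI := finite_quot hc
  letI := Fintype.ofFinite (Eis ⧸ Ideal.span {c})
  haveI := finite_quot hd
  letI := Fintype.ofFinite (Eis ⧸ Ideal.span {d})
  simp only [sumMod_eq_sum]
  exact Finset.sum_comm

lemma sumMod_const {c : Eis} (hc : c ≠ 0) (z : ℂ) : sumMod c (fun _ => z) = Nm c * z := by
  haveI := finite_quot hc
  letI := Fintype.ofFinite (Eis ⧸ Ideal.span {c})
  rw [sumMod_eq_sum, Finset.sum_const, nsmul_eq_mul, Finset.card_univ, ← Nat.card_eq_fintype_card,
    card_quot, ← NmN_cast]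
  simp

lemma sumMod_one (F : Eis → ℂ) (hF : Per 1 F) : sumMod 1 F = F 0 := by
  have : sumMod 1 F = sumMod 1 (fun _ => F 0) :=
    sumMod_congr (fun d => hF _ _ (one_dvd _))
  rw [this, sumMod_const one_ne_zero, Nm_one]; simp

lemma sumMod_scale {c u : Eis} (hc : c ≠ 0) (hu : IsCoprime c u) {F : Eis → ℂ} (hF : Per c F) :
    sumMod c F = sumMod c (fun d => F (u * d)) := by
  haveI := finite_quot hc
  refine sumMod_of_bij hF (fun d : Eis ⧸ Ideal.span {c} => u * d.out) ?_
  rw [← Finite.injective_iff_bijective]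
  intro a b hab
  simp only [mk_eq_mk] at hab
  rw [← mul_sub] at hab
  have := hu.dvd_of_dvd_mul_left hab
  rw [← mk_eq_mk, mk_out, mk_out] at this
  exact this

lemma sumMod_shift {c : Eis} (hc : c ≠ 0) (t : Eis) {F : Eis → ℂ} (hF : Per c F) :
    sumMod c F = sumMod c (fun d => F (d + t)) := by
  haveI := finite_quot hc
  refine sumMod_of_bij hF (fun d : Eis ⧸ Ideal.span {c} => d.out + t) ?_
  rw [← Finite.injective_iff_bijective]
  intro a b hab
  simp only [mk_eq_mk, add_sub_add_right_eq_sub] at hab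
  rw [← mk_eq_mk, mk_out, mk_out] at hab
  exact hab

lemma sumMod_pair {x y : Eis} (hx : x ≠ 0) (hy : y ≠ 0) {F : Eis → ℂ} (hF : Per (x * y) F) (φ : Eis → Eis → Eis)
    (hφ : ∀ a a' b b', x * y ∣ φ a b - φ a' b' → x ∣ a - a')
    (hφ2 : ∀ a b b', x * y ∣ φ a b - φ a b' → y ∣ b - b') :
    sumMod (x * y) F = sumMod x (fun a => sumMod y (fun b => F (φ a b))) := by
  haveI := finite_quot hx
  haveI := finite_quot hy
  haveI := finite_quot (mul_ne_zero hx hy)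
  letI := Fintype.ofFinite (Eis ⧸ Ideal.span {x})
  letI := Fintype.ofFinite (Eis ⧸ Ideal.span {y})
  letI := Fintype.ofFinite (Eis ⧸ Ideal.span {x * y})
  rw [sumMod_of_bij hF (fun d : (Eis ⧸ Ideal.span {x}) × (Eis ⧸ Ideal.span {y}) => φ d.1.out d.2.out),
    finsum_eq_sum_of_fintype, Fintype.sum_prod_type]
  · simp only [sumMod_eq_sum]
  · rw [Fintype.bijective_iff_injective_and_card]
    constructor
    · rintro ⟨a, b⟩ ⟨a', b'⟩ h
      simp only [mk_eq_mk] at h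
      have h1 := hφ _ _ _ _ h
      rw [← mk_eq_mk, mk_out, mk_out] at h1
      subst h1
      have h2 := hφ2 _ _ _ h
      rw [← mk_eq_mk, mk_out, mk_out] at h2
      exact Prod.ext rfl h2
    · rw [Fintype.card_prod]
      simp only [← Nat.card_eq_fintype_card, card_quot, NmN_mul]

lemma sumMod_split {x y : Eis} (hx : x ≠ 0) (hy : y ≠ 0) {F : Eis → ℂ} (hF : Per (x * y) F) :
    sumMod (x * y) F = sumMod x (fun a => sumMod y (fun b => F (a + x * b))) := by
  refine sumMod_pair hx hy hF (fun a b => a + x * b) ?_ ?_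
  · intro a a' b b' h
    have h2 : x ∣ (a + x * b) - (a' + x * b') := dvd_trans (dvd_mul_right _ _) h
    have h3 := dvd_sub h2 (dvd_mul_right x (b - b'))
    convert h3 using 1; ring
  · intro a b b' h
    have e : (a + x * b) - (a + x * b') = x * (b - b') := by ring
    simp only [e] at h
    exact (mul_dvd_mul_iff_left hx).1 h

lemma sumMod_crt {x y : Eis} (hx : x ≠ 0) (hy : y ≠ 0) (hxy : IsCoprime x y) {F : Eis → ℂ} (hF : Per (x * y) F) :
    sumMod (x * y) F = sumMod x (fun a => sumMod y (fun b => F (y * a + x * b))) := by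
  refine sumMod_pair hx hy hF (fun a b => y * a + x * b) ?_ ?_
  · intro a a' b b' h
    apply hxy.dvd_of_dvd_mul_left
    have h3 := dvd_sub (dvd_trans (dvd_mul_right _ _) h) (dvd_mul_right x (b - b'))
    convert h3 using 1; ring
  · intro a b b' h
    have e : (y * a + x * b) - (y * a + x * b') = x * (b - b') := by ring
    simp only [e] at h
    exact (mul_dvd_mul_iff_left hx).1 h

/-! Additive character. -/
lemma eE_add (z w : ℂ) : eE (z + w) = eE z * eE w := by
  unfold eE; rw [← Complex.exp_add, map_add]; congr 1; ring
lemma eE_zero : eE 0 = 1 := by simp [eE]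
lemma eE_eis (x : Eis) : eE (x : ℂ) = 1 := by
  obtain ⟨m, n, rfl⟩ := exists_coords x
  unfold eE
  rw [Complex.exp_eq_one_iff]
  refine ⟨2 * m - n, ?_⟩
  have : ((m + n * ωE : Eis) : ℂ) + (starRingEnd ℂ) ((m + n * ωE : Eis) : ℂ) = ((2 * m - n : ℤ) : ℂ) := by
    apply Complex.ext
    · simp [ωE, omc_re]; ring
    · simp
  rw [this]; ring
lemma eE_neg (z : ℂ) : eE (-z) = (starRingEnd ℂ) (eE z) := by
  unfold eE
  rw [← Complex.exp_conj]; congr 1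
  have h2 : (starRingEnd ℂ) 2 = 2 := map_ofNat _ 2
  simp [h2]; ring
lemma eE_norm (z : ℂ) : ‖eE z‖ = 1 := by
  unfold eE
  have : (2 * Real.pi * Complex.I * (z + (starRingEnd ℂ) z) : ℂ) = ((4 * Real.pi * z.re : ℝ) : ℂ) * Complex.I := by
    rw [Complex.add_conj]; push_cast; ring
  rw [this, Complex.norm_exp_ofReal_mul_I]
lemma eE_sub_eis (z w : ℂ) (x : Eis) (h : z - w = x) : eE z = eE w := by
  have : z = w + x := by rw [← h]; ring
  rw [this, eE_add, eE_eis, mul_one]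
lemma eE_one_imp {z : ℂ} (h : eE z = 1) : ∃ k : ℤ, z + (starRingEnd ℂ) z = k := by
  unfold eE at h
  rw [Complex.exp_eq_one_iff] at h
  obtain ⟨k, hk⟩ := h
  refine ⟨k, ?_⟩
  have h2 : (2 * Real.pi * Complex.I : ℂ) ≠ 0 := by simp [Real.pi_ne_zero]
  apply mul_left_cancel₀ h2
  rw [hk]; ring

lemma coe_ne {c : Eis} (hc : c ≠ 0) : (c : ℂ) ≠ 0 := fun h => hc (Subtype.ext h)

lemma eE_per {c : Eis} (hc : c ≠ 0) (m : Eis) : Per c (fun d => eE (((m * d : Eis) : ℂ) / (c : ℂ))) := by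
  rintro a b ⟨k, hk⟩
  refine eE_sub_eis _ _ (m * k) ?_
  have : a = b + c * k := by rw [← hk]; ring
  have h0 := coe_ne hc
  rw [this]; push_cast; field_simp; ring

/-- Nondegeneracy. -/
lemma eE_nondeg {c n : Eis} (hc : Pr c) (h : ∀ d : Eis, eE (((n * d : Eis) : ℂ) / (c : ℂ)) = 1) : c ∣ n := by
  have h0 := coe_ne (Pr_ne_zero hc)
  obtain ⟨k, hk⟩ := eE_one_imp (h 1)
  obtain ⟨l, hl⟩ := eE_one_imp (h ωE)
  set z : ℂ := (n : ℂ) / c with hz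
  have e1 : ((n * 1 : Eis) : ℂ) / c = z := by simp [hz]
  have e2 : ((n * ωE : Eis) : ℂ) / c = z * ωc := by rw [hz]; push_cast; simp only [ωE]; ring
  rw [e1] at hk
  rw [e2, map_mul] at hl
  have hw : (starRingEnd ℂ) ωc = -1 - ωc := by
    have := congrArg Subtype.val cj_om
    rw [omE_sq] at this
    simpa [cj_coe, ωE] using this
  rw [hw] at hl
  have h3 : (1 + 2 * ωc) * z = (k + l) + k * ωc := by linear_combination (1 + ωc) * hk + hl
  have h3' : (1 + 2 * ωE) * n = c * ((k + l) + k * ωE) := by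
    apply Subtype.ext
    have : (n : ℂ) = c * z := by rw [hz]; field_simp
    have e : (((1 + 2 * ωE) * n : Eis) : ℂ) = (1 + 2 * ωc) * n := by
      have h2 : ((2 : Eis) : ℂ) = 2 := rfl
      simp [ωE, h2]
    have e' : ((c * ((k + l) + k * ωE) : Eis) : ℂ) = c * ((k + l) + k * ωc) := by simp [ωE]
    rw [e, e', ← h3, this]; ring
  have h4 : c ∣ 3 * n := by
    refine ⟨((k + l) + k * ωE) * (-(1 + 2 * ωE)), ?_⟩
    rw [← mul_assoc, ← h3']
    linear_combination (4 * n) * omE_sq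
  exact (Pr_coprime hc).dvd_of_dvd_mul_left h4

open Classical in
lemma sumMod_eE {c : Eis} (hc : Pr c) (n : Eis) :
    sumMod c (fun d => eE (((n * d : Eis) : ℂ) / (c : ℂ))) = if c ∣ n then (Nm c : ℂ) else 0 := by
  have hc0 := Pr_ne_zero hc
  split_ifs with h
  · obtain ⟨k, rfl⟩ := h
    have : ∀ d : Eis, eE (((c * k * d : Eis) : ℂ) / (c : ℂ)) = 1 := by
      intro d
      rw [← eE_eis (k * d)]; congr 1
      have := coe_ne hc0
      push_cast; field_simp
    rw [sumMod_congr this, sumMod_const hc0, mul_one]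
  · have : ∃ t : Eis, eE (((n * t : Eis) : ℂ) / (c : ℂ)) ≠ 1 := by
      by_contra! h'
      exact h (eE_nondeg hc h')
    obtain ⟨t, ht⟩ := this
    have e := sumMod_shift hc0 t (eE_per hc0 n)
    have e2 : ∀ d : Eis, eE (((n * (d + t) : Eis) : ℂ) / (c : ℂ)) =
        eE (((n * t : Eis) : ℂ) / (c : ℂ)) * eE (((n * d : Eis) : ℂ) / (c : ℂ)) := by
      intro d
      rw [← eE_add]; congr 1; push_cast; ring
    rw [sumMod_congr e2, sumMod_mul_left hc0] at e
    have : (eE (((n * t : Eis) : ℂ) / (c : ℂ)) - 1) * sumMod c (fun d => eE (((n * d : Eis) : ℂ) / (c : ℂ))) = 0 := by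
      linear_combination -e
    exact (mul_eq_zero.1 this).resolve_left (sub_ne_zero.2 ht)

end

section

variable {χ : Eis → Eis → Eis}

/-- Auxiliary Gauss sum with the `k`-th power of the character. -/
def gk (χ : Eis → Eis → Eis) (k : ℕ) (m c : Eis) : ℂ :=
  sumMod c (fun d => ((χ c d : Eis) : ℂ) ^ k * eE (((m * d : Eis) : ℂ) / (c : ℂ)))

lemma g_eq (χ : Eis → Eis → Eis) (m c : Eis) :
    g₃ χ m c = sumMod c (fun d => ((χ c d : Eis) : ℂ) * eE (((m * d : Eis) : ℂ) / (c : ℂ))) := rfl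

lemma gk_one (χ : Eis → Eis → Eis) (m c : Eis) : gk χ 1 m c = g₃ χ m c := by
  rw [g_eq]; unfold gk; simp

lemma gk_per (hχ : IsCubicSymbol χ) {c : Eis} (hc : Pr c) (k : ℕ) (m : Eis) :
    Per c (fun d => ((χ c d : Eis) : ℂ) ^ k * eE (((m * d : Eis) : ℂ) / (c : ℂ))) := by
  intro a b h
  have h2 := eE_per (Pr_ne_zero hc) m a b h
  simp only at h2 ⊢
  rw [chi_congr hχ hc h, h2]

lemma g_per (hχ : IsCubicSymbol χ) {c : Eis} (hc : Pr c) (m : Eis) :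
    Per c (fun d => ((χ c d : Eis) : ℂ) * eE (((m * d : Eis) : ℂ) / (c : ℂ))) := by
  intro a b h
  have h2 := eE_per (Pr_ne_zero hc) m a b h
  simp only at h2 ⊢
  rw [chi_congr hχ hc h, h2]

lemma X_conj (hχ : IsCubicSymbol χ) {c : Eis} (hc : Pr c) (a : Eis) :
    (starRingEnd ℂ) ((χ c a : Eis) : ℂ) = ((χ c a : Eis) : ℂ) ^ 2 := by
  rw [← cj_coe, Val_cj (chi_val hχ hc a)]; simp

lemma X_cube (hχ : IsCubicSymbol χ) {c : Eis} (hc : Pr c) {a : Eis} (h : IsCoprime c a) :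
    ((χ c a : Eis) : ℂ) ^ 3 = 1 := by
  have := congrArg Subtype.val (chi_cube hχ hc h)
  simpa using this

lemma X_zero (hχ : IsCubicSymbol χ) {c : Eis} (hc : Pr c) {a : Eis} (h : ¬ IsCoprime c a) :
    ((χ c a : Eis) : ℂ) = 0 := by
  rw [(chi_eq_zero hχ hc a).2 h]; rfl

lemma X_mul (hχ : IsCubicSymbol χ) {c : Eis} (hc : Pr c) (a b : Eis) :
    ((χ c (a * b) : Eis) : ℂ) = (χ c a : Eis) * (χ c b : Eis) := by
  rw [chi_mul hχ hc]; rfl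

lemma X_norm_le (hχ : IsCubicSymbol χ) {c : Eis} (hc : Pr c) (a : Eis) : ‖((χ c a : Eis) : ℂ)‖ ≤ 1 := by
  by_cases h : IsCoprime c a
  · have := congrArg norm (X_cube hχ hc h)
    rw [norm_pow, norm_one] at this
    exact le_of_eq ((pow_eq_one_iff_of_nonneg (norm_nonneg _) (by norm_num)).1 this)
  · rw [X_zero hχ hc h]; simp

lemma X_norm (hχ : IsCubicSymbol χ) {c : Eis} (hc : Pr c) {a : Eis} (h : IsCoprime c a) :
    ‖((χ c a : Eis) : ℂ)‖ = 1 := by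
  have := congrArg norm (X_cube hχ hc h)
  rw [norm_pow, norm_one] at this
  exact (pow_eq_one_iff_of_nonneg (norm_nonneg _) (by norm_num)).1 this

lemma gk_scale (hχ : IsCubicSymbol χ) {c u : Eis} (hc : Pr c) (h : IsCoprime c u) (k : ℕ) (m : Eis) :
    gk χ k m c = ((χ c u : Eis) : ℂ) ^ k * gk χ k (m * u) c := by
  unfold gk
  rw [sumMod_scale (Pr_ne_zero hc) h (gk_per hχ hc k m), ← sumMod_mul_left (Pr_ne_zero hc)]
  apply sumMod_congr
  intro d
  rw [X_mul hχ hc, mul_assoc m u d]; ring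

/-- `g₃(mu, c) = conj χ_c(u) g₃(m, c)`. -/
lemma g_scale (hχ : IsCubicSymbol χ) {c u : Eis} (hc : Pr c) (h : IsCoprime c u) (m : Eis) :
    g₃ χ (m * u) c = ((χ c u : Eis) : ℂ) ^ 2 * g₃ χ m c := by
  have := gk_scale hχ hc h 1 m
  rw [gk_one, gk_one, pow_one] at this
  rw [this]
  linear_combination (-g₃ χ (m * u) c) * X_cube hχ hc h

lemma g_one (hχ : IsCubicSymbol χ) (m : Eis) : g₃ χ m 1 = 1 := by
  rw [g_eq, sumMod_one _ (g_per hχ Pr_one m), hχ.one_bot]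
  simp [eE_zero]

lemma g_mul (hχ : IsCubicSymbol χ) {x y : Eis} (hx : Pr x) (hy : Pr y) (h : IsCoprime x y) (m : Eis) :
    g₃ χ m (x * y) = (((χ x y : Eis) : ℂ) * g₃ χ m x) * (((χ y x : Eis) : ℂ) * g₃ χ m y) := by
  have hx0 := Pr_ne_zero hx
  have hy0 := Pr_ne_zero hy
  rw [g_eq, sumMod_crt hx0 hy0 h (g_per hχ (Pr_mul hx hy) m)]
  have key : ∀ a b : Eis, ((χ (x * y) (y * a + x * b) : Eis) : ℂ) *
      eE (((m * (y * a + x * b) : Eis) : ℂ) / ((x * y : Eis) : ℂ)) =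
      (((χ x y : Eis) : ℂ) * (((χ x a : Eis) : ℂ) * eE (((m * a : Eis) : ℂ) / (x : ℂ)))) *
      (((χ y x : Eis) : ℂ) * (((χ y b : Eis) : ℂ) * eE (((m * b : Eis) : ℂ) / (y : ℂ)))) := by
    intro a b
    have e1 : χ x (y * a + x * b) = χ x (y * a) := chi_congr hχ hx ⟨b, by ring⟩
    have e2 : χ y (y * a + x * b) = χ y (x * b) := chi_congr hχ hy ⟨a, by ring⟩
    have e3 : eE (((m * (y * a + x * b) : Eis) : ℂ) / ((x * y : Eis) : ℂ)) =
        eE (((m * a : Eis) : ℂ) / (x : ℂ)) * eE (((m * b : Eis) : ℂ) / (y : ℂ)) := by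
      rw [← eE_add]; congr 1
      have := coe_ne hx0
      have := coe_ne hy0
      push_cast; field_simp
    rw [hχ.mul_bot _ _ _ hx hy, e1, e2, e3, Subring.coe_mul, X_mul hχ hx, X_mul hχ hy]; ring
  rw [sumMod_congr (fun a => sumMod_congr (fun b => key a b))]
  rw [sumMod_congr (fun a => sumMod_mul_left hy0 _ _)]
  simp_rw [mul_comm _ (sumMod y _)]
  rw [sumMod_mul_left hx0, sumMod_mul_left hx0, sumMod_mul_left hy0, ← g_eq, ← g_eq]; ring

lemma g_mul' (hχ : IsCubicSymbol χ) {x y : Eis} (hx : Pr x) (hy : Pr y) (h : IsCoprime x y) (m : Eis) :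
    g₃ χ m (x * y) = g₃ χ (m * y) x * g₃ χ m y := by
  rw [g_mul hχ hx hy h, g_scale hχ hx h, recip hχ hx hy h]; ring

lemma X_pp (hχ : IsCubicSymbol χ) {p : Eis} (hp : Pr p) (k : ℕ) (d : Eis) :
    ((χ (p * p ^ k) d : Eis) : ℂ) = ((χ p d : Eis) : ℂ) ^ (k + 1) := by
  rw [← pow_succ', chi_pow hχ hp]; push_cast; rfl

/-- Prime power reduction. -/
lemma g_pp (hχ : IsCubicSymbol χ) {p : Eis} (hp : Pr p) (k : ℕ) (n : Eis) :
    g₃ χ (p ^ k * n) (p ^ (k + 1)) = (Nm p : ℂ) ^ k * gk χ (k + 1) n p := by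
  have hp0 := Pr_ne_zero hp
  have hk0 : p ^ k ≠ 0 := pow_ne_zero _ hp0
  have hper := g_per hχ (Pr_pow hp (k + 1)) (p ^ k * n)
  rw [g_eq, pow_succ']
  rw [pow_succ'] at hper
  rw [sumMod_split hp0 hk0 hper]
  have key : ∀ a b : Eis, ((χ (p * p ^ k) (a + p * b) : Eis) : ℂ) *
      eE (((p ^ k * n * (a + p * b) : Eis) : ℂ) / ((p * p ^ k : Eis) : ℂ)) =
      ((χ p a : Eis) : ℂ) ^ (k + 1) * eE (((n * a : Eis) : ℂ) / (p : ℂ)) := by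
    intro a b
    have e1 : χ p (a + p * b) = χ p a := chi_congr hχ hp ⟨b, by ring⟩
    have e2 : eE (((p ^ k * n * (a + p * b) : Eis) : ℂ) / ((p * p ^ k : Eis) : ℂ)) =
        eE (((n * a : Eis) : ℂ) / (p : ℂ)) := by
      refine eE_sub_eis _ _ (n * b) ?_
      have := coe_ne hp0
      push_cast; field_simp; ring
    rw [X_pp hχ hp, e1, e2]
  rw [sumMod_congr (fun a => sumMod_congr (fun b => key a b))]
  rw [sumMod_congr (fun a => sumMod_const hk0 _), sumMod_mul_left hp0, Nm_pow]
  unfold gk; push_cast; rfl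

lemma g_pp_zero (hχ : IsCubicSymbol χ) {p : Eis} (hp : Pr p) (k : ℕ) (m : Eis) (h : ¬ p ^ k ∣ m) :
    g₃ χ m (p ^ (k + 1)) = 0 := by
  have hp0 := Pr_ne_zero hp
  have hk0 : p ^ k ≠ 0 := pow_ne_zero _ hp0
  have hper := g_per hχ (Pr_pow hp (k + 1)) m
  rw [g_eq, pow_succ']
  rw [pow_succ'] at hper
  rw [sumMod_split hp0 hk0 hper]
  have key : ∀ a b : Eis, ((χ (p * p ^ k) (a + p * b) : Eis) : ℂ) *
      eE (((m * (a + p * b) : Eis) : ℂ) / ((p * p ^ k : Eis) : ℂ)) =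
      (((χ p a : Eis) : ℂ) ^ (k + 1) * eE (((m * a : Eis) : ℂ) / ((p * p ^ k : Eis) : ℂ))) *
      eE (((m * b : Eis) : ℂ) / ((p ^ k : Eis) : ℂ)) := by
    intro a b
    have e1 : χ p (a + p * b) = χ p a := chi_congr hχ hp ⟨b, by ring⟩
    rw [mul_assoc, ← eE_add]
    rw [X_pp hχ hp, e1]
    congr 2
    have := coe_ne hp0
    push_cast; field_simp
  rw [sumMod_congr (fun a => sumMod_congr (fun b => key a b))]
  rw [sumMod_congr (fun a => sumMod_mul_left hk0 _ _), sumMod_eE (Pr_pow hp k), if_neg h]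
  simp only [mul_zero]
  rw [sumMod_const hp0, mul_zero]

open Classical in
lemma sumMod_ite {c : Eis} (t : Eis) {F : Eis → ℂ} (hF : Per c F) :
    sumMod c (fun d => if c ∣ d - t then F d else 0) = F t := by
  unfold sumMod
  rw [finsum_eq_single _ (Ideal.Quotient.mk (Ideal.span {c}) t)]
  · simp only []
    rw [if_pos (out_mk c t)]; exact hF _ _ (out_mk c t)
  · intro x hx
    simp only []
    rw [if_neg]
    intro h
    rw [← mk_eq_mk, mk_out] at h
    exact hx h

lemma gk_add_three (hχ : IsCubicSymbol χ) {p : Eis} (hp : Pr p) (k : ℕ) (n : Eis) :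
    gk χ (k + 1 + 3) n p = gk χ (k + 1) n p := by
  unfold gk
  apply sumMod_congr
  intro d
  by_cases h : IsCoprime p d
  · rw [pow_add _ (k + 1) 3, X_cube hχ hp h, mul_one]
  · rw [X_zero hχ hp h]; simp

lemma gk_two (hχ : IsCubicSymbol χ) {p : Eis} (hp : Pr p) (n : Eis) :
    gk χ 2 n p = (starRingEnd ℂ) (g₃ χ n p) := by
  rw [gk_scale hχ hp (isCoprime_one_right.neg_right) 2 n, chi_neg_one hχ hp, g_eq,
    ← sumMod_conj (Pr_ne_zero hp)]
  simp only [OneMemClass.coe_one, one_pow, one_mul]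
  unfold gk
  apply sumMod_congr
  intro d
  rw [map_mul, X_conj hχ hp, ← eE_neg]
  congr 2
  push_cast; ring

lemma sumMod_sub {c : Eis} (hc : c ≠ 0) (F G : Eis → ℂ) :
    sumMod c (fun d => F d - G d) = sumMod c F - sumMod c G := by
  haveI := finite_quot hc
  letI := Fintype.ofFinite (Eis ⧸ Ideal.span {c})
  simp only [sumMod_eq_sum, Finset.sum_sub_distrib]

open Classical in
lemma gk_three (hχ : IsCubicSymbol χ) {p : Eis} (hp : Prime p) (hpp : Pr p) (n : Eis) :
    gk χ 3 n p = (if p ∣ n then (Nm p : ℂ) else 0) - 1 := by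
  rw [← sumMod_eE hpp n]
  have h1 := sumMod_ite 0 (eE_per (Pr_ne_zero hpp) n)
  simp only [mul_zero, ZeroMemClass.coe_zero, zero_div, eE_zero] at h1
  rw [← h1, ← sumMod_sub (Pr_ne_zero hpp)]
  unfold gk
  apply sumMod_congr
  intro d
  by_cases h : p ∣ d
  · rw [sub_zero, if_pos h, X_zero hχ hpp]
    · ring
    · rw [hp.coprime_iff_not_dvd]; exact not_not.2 h
  · rw [sub_zero, if_neg h, X_cube hχ hpp ((hp.coprime_iff_not_dvd).2 h)]; ring

lemma g_dvd (hχ : IsCubicSymbol χ) {p : Eis} (hp : Prime p) (hpp : Pr p) {n : Eis} (h : p ∣ n) :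
    g₃ χ n p = 0 := by
  have hu : ∃ u, IsCoprime p u ∧ χ p u ≠ 1 := by
    by_contra! h
    apply chiM_ne_one hχ hp hpp
    ext u
    have hu := u.isUnit
    rw [← mk_out (u : Eis ⧸ Ideal.span {p})] at hu ⊢
    rw [chiM_mk, MulChar.one_apply hu, h]
    rw [hp.coprime_iff_not_dvd]
    intro h2
    have : Ideal.Quotient.mk (Ideal.span {p}) (u : Eis ⧸ Ideal.span {p}).out = 0 := by
      rw [Ideal.Quotient.eq_zero_iff_mem, Ideal.mem_span_singleton]; exact h2
    rw [this] at hu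
    haveI := span_max hp
    exact not_isUnit_zero hu
  obtain ⟨u, hu, hu1⟩ := hu
  have h1 := gk_scale hχ hpp hu 1 n
  have h2 : gk χ 1 (n * u) p = gk χ 1 n p := by
    unfold gk
    apply sumMod_congr
    intro d
    congr 1
    obtain ⟨k, rfl⟩ := h
    have := coe_ne hp.ne_zero
    refine eE_sub_eis _ _ (k * u * d - k * d) ?_
    push_cast; field_simp
  rw [h2, gk_one, pow_one] at h1
  have h3 : (((χ p u : Eis) : ℂ) - 1) * g₃ χ n p = 0 := by linear_combination -h1
  refine (mul_eq_zero.1 h3).resolve_left ?_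
  intro h4
  apply hu1
  apply Subtype.ext
  simpa [sub_eq_zero] using h4

end

section

variable {χ : Eis → Eis → Eis}

lemma sumMod_mul_right {c : Eis} (hc : c ≠ 0) (F : Eis → ℂ) (z : ℂ) :
    sumMod c (fun d => F d * z) = sumMod c F * z := by
  rw [mul_comm _ z, ← sumMod_mul_left hc]; exact sumMod_congr (fun d => mul_comm _ _)

open Classical in
lemma parseval {c : Eis} (hc : Pr c) {F : Eis → ℂ} (hF : Per c F) :
    sumMod c (fun t => sumMod c (fun d => F d * eE (((t * d : Eis) : ℂ) / (c : ℂ))) *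
      (starRingEnd ℂ) (sumMod c (fun d => F d * eE (((t * d : Eis) : ℂ) / (c : ℂ))))) =
    Nm c * sumMod c (fun d => F d * (starRingEnd ℂ) (F d)) := by
  have hc0 := Pr_ne_zero hc
  have e1 : ∀ t : Eis, sumMod c (fun d => F d * eE (((t * d : Eis) : ℂ) / (c : ℂ))) *
      (starRingEnd ℂ) (sumMod c (fun d => F d * eE (((t * d : Eis) : ℂ) / (c : ℂ)))) =
      sumMod c (fun d => sumMod c (fun d' => (F d * (starRingEnd ℂ) (F d')) *
        eE ((((d - d') * t : Eis) : ℂ) / (c : ℂ)))) := by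
    intro t
    rw [← sumMod_conj hc0, ← sumMod_mul_right hc0]
    apply sumMod_congr
    intro d
    rw [← sumMod_mul_left hc0]
    apply sumMod_congr
    intro d'
    rw [map_mul, ← eE_neg]
    have : eE ((((d - d') * t : Eis) : ℂ) / (c : ℂ)) =
      eE (((t * d : Eis) : ℂ) / (c : ℂ)) * eE (-(((t * d' : Eis) : ℂ) / (c : ℂ))) := by
      rw [← eE_add]; congr 1; push_cast; ring
    rw [this]; ring
  rw [sumMod_congr e1, sumMod_comm hc0 hc0, ← sumMod_mul_left hc0]
  apply sumMod_congr
  intro d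
  rw [sumMod_comm hc0 hc0]
  rw [sumMod_congr (fun d' => sumMod_mul_left hc0 _ _)]
  rw [sumMod_congr (fun d' => congrArg _ (sumMod_eE hc (d - d')))]
  rw [← sumMod_ite (c := c) d (F := fun d' => (Nm c : ℂ) * (F d * (starRingEnd ℂ) (F d')))]
  · apply sumMod_congr
    intro d'
    rw [dvd_sub_comm]
    split_ifs <;> ring
  · intro a b h
    simp only [hF a b h]

lemma g_norm_sq (hχ : IsCubicSymbol χ) {p : Eis} (hp : Prime p) (hpp : Pr p) {n : Eis} (h : ¬ p ∣ n) :
    g₃ χ n p * (starRingEnd ℂ) (g₃ χ n p) = Nm p := by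
  classical
  have hp0 := hp.ne_zero
  have hF : Per p (fun d => ((χ p d : Eis) : ℂ)) := fun a b h => by simp only [chi_congr hχ hpp h]
  have P := parseval hpp hF
  have hsq : ∀ d : Eis, ((χ p d : Eis) : ℂ) * (starRingEnd ℂ) ((χ p d : Eis) : ℂ) =
      1 - if p ∣ d - 0 then 1 else 0 := by
    intro d
    rw [X_conj hχ hpp, sub_zero]
    split_ifs with h
    · rw [X_zero hχ hpp]
      · simp
      · rw [hp.coprime_iff_not_dvd]; exact not_not.2 h
    · rw [← pow_succ', X_cube hχ hpp ((hp.coprime_iff_not_dvd).2 h)]; simp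
  have hsum : sumMod p (fun d => (1 : ℂ) - if p ∣ d - 0 then 1 else 0) = Nm p - 1 := by
    rw [sumMod_sub hp0, sumMod_const hp0, sumMod_ite (c := p) 0 (F := fun _ => 1)]
    · ring
    · intro _ _ _; rfl
  rw [sumMod_congr hsq, hsum] at P
  have hg : ∀ t : Eis, g₃ χ t p * (starRingEnd ℂ) (g₃ χ t p) =
      (g₃ χ 1 p * (starRingEnd ℂ) (g₃ χ 1 p)) * (1 - if p ∣ t - 0 then 1 else 0) := by
    intro t
    rw [sub_zero]
    split_ifs with ht
    · rw [g_dvd hχ hp hpp ht]; simp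
    · have hc := (hp.coprime_iff_not_dvd).2 ht
      have e := g_scale hχ hpp hc 1
      rw [one_mul] at e
      rw [e, map_mul, map_pow, X_conj hχ hpp]
      have e3 := X_cube hχ hpp hc
      have e6 : ((χ p t : Eis) : ℂ) ^ 6 = 1 := by
        have : ((χ p t : Eis) : ℂ) ^ 6 = (((χ p t : Eis) : ℂ) ^ 3) ^ 2 := by ring
        rw [this, e3]; norm_num
      linear_combination (g₃ χ 1 p * (starRingEnd ℂ) (g₃ χ 1 p)) * e6
  have P2 : sumMod p (fun t => g₃ χ t p * (starRingEnd ℂ) (g₃ χ t p)) = Nm p * (Nm p - 1) := P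
  rw [sumMod_congr hg, sumMod_mul_left hp0, hsum] at P2
  have hN : (Nm p : ℂ) - 1 ≠ 0 := by
    have := NmN_prime hp
    have h2 : (1 : ℝ) < NmN p := by exact_mod_cast this
    rw [NmN_cast] at h2
    rw [← Complex.ofReal_one, ← Complex.ofReal_sub, Complex.ofReal_ne_zero]
    linarith
  rw [hg n, sub_zero, if_neg h, mul_right_cancel₀ hN P2]; ring

lemma g_norm_sq' (hχ : IsCubicSymbol χ) {p : Eis} (hp : Prime p) (hpp : Pr p) {n : Eis} (h : ¬ p ∣ n) :
    ‖g₃ χ n p‖ ^ 2 = Nm p := by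
  have := g_norm_sq hχ hp hpp h
  rw [Complex.mul_conj, Complex.normSq_eq_norm_sq] at this
  exact_mod_cast this

lemma gk_norm (hχ : IsCubicSymbol χ) {p : Eis} (hp : Prime p) (hpp : Pr p) {n : Eis} (h : ¬ p ∣ n) (k : ℕ) :
    ‖gk χ (k + 1) n p‖ ^ 2 ≤ Nm p := by
  induction k using Nat.strong_induction_on with
  | _ k ih =>
    rcases k with _ | _ | _ | k
    · rw [zero_add, gk_one, g_norm_sq' hχ hp hpp h]
    · rw [zero_add, gk_two hχ hpp, RCLike.norm_conj, g_norm_sq' hχ hp hpp h]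
    · rw [zero_add, gk_three hχ hp hpp, if_neg h]
      simpa using one_le_Nm hp.ne_zero
    · have : k + 1 + 1 + 1 + 1 = k + 1 + 3 := by ring
      rw [this, gk_add_three hχ hpp]
      exact ih k (by omega)

lemma gk_norm_dvd (hχ : IsCubicSymbol χ) {p : Eis} (hp : Prime p) (hpp : Pr p) {n : Eis} (h : p ∣ n) (k : ℕ) :
    ‖gk χ (k + 1) n p‖ ≤ Nm p := by
  induction k using Nat.strong_induction_on with
  | _ k ih =>
    rcases k with _ | _ | _ | k
    · rw [zero_add, gk_one, g_dvd hχ hp hpp h]; simpa using Nm_nonneg p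
    · rw [zero_add, gk_two hχ hpp, RCLike.norm_conj, g_dvd hχ hp hpp h]; simpa using Nm_nonneg p
    · rw [zero_add, gk_three hχ hp hpp, if_pos h, ← Complex.ofReal_one, ← Complex.ofReal_sub,
        Complex.norm_real, Real.norm_eq_abs, abs_of_nonneg (by linarith [one_le_Nm hp.ne_zero])]
      linarith
    · have : k + 1 + 1 + 1 + 1 = k + 1 + 3 := by ring
      rw [this, gk_add_three hχ hpp]
      exact ih k (by omega)

lemma g_bound_aux (hχ : IsCubicSymbol χ) (m c : Eis) (hc : Pr c) :
    ∃ g, g ∣ m ∧ g ∣ c ∧ ‖g₃ χ m c‖ ^ 2 ≤ Nm c * Nm g := by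
  refine primary_induction_coprime (P := fun c => ∃ g, g ∣ m ∧ g ∣ c ∧ ‖g₃ χ m c‖ ^ 2 ≤ Nm c * Nm g) ?_ ?_ ?_ c hc
  · exact ⟨1, one_dvd _, one_dvd _, by rw [g_one hχ]; simp [Nm_one]⟩
  · intro p k hp hpp
    by_cases h : p ^ k ∣ m
    · obtain ⟨n, rfl⟩ := h
      have hN := Nm_nonneg p
      by_cases hn : p ∣ n
      · refine ⟨p ^ (k + 1), ?_, dvd_rfl, ?_⟩
        · rw [pow_succ]; exact mul_dvd_mul_left _ hn
        · rw [g_pp hχ hpp, norm_mul, norm_pow, Complex.norm_real, Real.norm_eq_abs, abs_of_nonneg hN, Nm_pow]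
          have := gk_norm_dvd hχ hp hpp hn k
          calc (Nm p ^ k * ‖gk χ (k + 1) n p‖) ^ 2 ≤ (Nm p ^ k * Nm p) ^ 2 := by gcongr
            _ = _ := by ring
      · refine ⟨p ^ k, dvd_mul_right _ _, pow_dvd_pow _ (by omega), ?_⟩
        rw [g_pp hχ hpp, norm_mul, norm_pow, Complex.norm_real, Real.norm_eq_abs, abs_of_nonneg hN, Nm_pow, Nm_pow]
        have := gk_norm hχ hp hpp hn k
        calc (Nm p ^ k * ‖gk χ (k + 1) n p‖) ^ 2 = (Nm p ^ k) ^ 2 * ‖gk χ (k + 1) n p‖ ^ 2 := by ring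
            _ ≤ (Nm p ^ k) ^ 2 * Nm p := by gcongr
            _ = _ := by ring
    · refine ⟨1, one_dvd _, one_dvd _, ?_⟩
      rw [g_pp_zero hχ hpp k m h]
      simp [Nm_one, Nm_nonneg]
  · rintro x y hx hy hxy ⟨g, hg1, hg2, hg3⟩ ⟨g', hg1', hg2', hg3'⟩
    refine ⟨g * g', (hxy.of_isCoprime_of_dvd_left hg2 |>.of_isCoprime_of_dvd_right hg2').mul_dvd hg1 hg1', mul_dvd_mul hg2 hg2', ?_⟩
    rw [g_mul hχ hx hy hxy]
    simp only [norm_mul, X_norm hχ hx hxy, X_norm hχ hy hxy.symm, one_mul, Nm_mul]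
    calc (‖g₃ χ m x‖ * ‖g₃ χ m y‖) ^ 2 = ‖g₃ χ m x‖ ^ 2 * ‖g₃ χ m y‖ ^ 2 := by ring
      _ ≤ (Nm x * Nm g) * (Nm y * Nm g') := by
        apply mul_le_mul hg3 hg3' (by positivity) (mul_nonneg (Nm_nonneg _) (Nm_nonneg _))
      _ = _ := by ring

lemma g_bound (hχ : IsCubicSymbol χ) {m c : Eis} (hm : m ≠ 0) (hc : Pr c) :
    ‖g₃ χ m c‖ ≤ (Nm m) ^ (1/2 : ℝ) * Nm c ^ (1/2 : ℝ) := by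
  obtain ⟨g, h1, -, h3⟩ := g_bound_aux hχ m c hc
  have h4 := Nm_le_of_dvd h1 hm
  rw [← Real.mul_rpow (Nm_nonneg _) (Nm_nonneg _), ← Real.sqrt_eq_rpow]
  apply Real.le_sqrt_of_sq_le
  calc _ ≤ _ := h3
    _ ≤ Nm c * Nm m := by gcongr; exact Nm_nonneg c
    _ = _ := by ring

lemma Nm_lower (v : Fin 2 → ℤ) : (3/4 : ℝ) * ‖v‖ ^ 2 ≤ Nm (coordsEquiv v) := by
  rw [coordsEquiv_apply, Nm_coords]
  have : ‖v‖ ^ 2 ≤ max ((v 0 : ℝ) ^ 2) ((v 1 : ℝ) ^ 2) := by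
    have h1 : ‖v‖ ≤ max |(v 0 : ℝ)| |(v 1 : ℝ)| := by
      refine (pi_norm_le_iff_of_nonneg (le_max_of_le_left (abs_nonneg _))).2 ?_
      intro i
      fin_cases i
      · simp [Int.norm_eq_abs]
      · simp [Int.norm_eq_abs]
    rcases le_max_iff.1 h1 with h | h
    · apply le_max_of_le_left
      rw [← sq_abs (v 0 : ℝ)]; gcongr
    · apply le_max_of_le_right
      rw [← sq_abs (v 1 : ℝ)]; gcongr
  push_cast
  rcases le_max_iff.1 this with h | h
  · nlinarith [sq_nonneg ((v 0 : ℝ) / 2 - v 1)]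
  · nlinarith [sq_nonneg ((v 1 : ℝ) / 2 - v 0)]

lemma summable_Nm {t : ℝ} (ht : 1 < t) : Summable (fun x : Eis => Nm x ^ (-t)) := by
  rw [← coordsEquiv.toEquiv.summable_iff]
  have := EisensteinSeries.summable_one_div_norm_rpow (k := 2 * t) (by linarith)
  refine Summable.of_nonneg_of_le (fun v => Real.rpow_nonneg (Nm_nonneg _) _) ?_ (this.mul_left ((3/4 : ℝ) ^ (-t)))
  intro v
  by_cases hv : v = 0
  · subst hv
    have h0 : Nm (coordsEquiv 0) = 0 := by rw [map_zero]; exact Nm_eq_zero.2 rfl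
    have h1 : (0 : ℝ) ^ (-t) = 0 := Real.zero_rpow (by linarith)
    simp only [Function.comp, LinearEquiv.coe_toEquiv, h0, h1]
    positivity
  · have hn : 0 < ‖v‖ := norm_pos_iff.2 hv
    have e : (3/4 : ℝ) ^ (-t) * ‖v‖ ^ (-(2 * t)) = ((3/4 : ℝ) * ‖v‖ ^ 2) ^ (-t) := by
      rw [Real.mul_rpow (by norm_num) (by positivity), ← Real.rpow_natCast, ← Real.rpow_mul hn.le]
      congr 2; push_cast; ring
    rw [e]
    exact Real.rpow_le_rpow_of_nonpos (by positivity) (Nm_lower v) (by linarith)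

lemma summable_g (hχ : IsCubicSymbol χ) {m : Eis} (hm : m ≠ 0) {s : ℂ} (hs : 3/2 < s.re) :
    Summable (fun c : {c : Eis // Pr c} => g₃ χ m c.1 * (Nm c.1 : ℂ) ^ (-s)) := by
  have h0 := (summable_Nm (t := s.re - 1/2) (by linarith)).comp_injective (i := fun c : {c : Eis // Pr c} => c.1) Subtype.val_injective
  refine Summable.of_norm_bounded (h0.mul_left (Nm m ^ (1/2 : ℝ))) ?_
  rintro ⟨c, hc⟩
  have hN := Nm_pos (Pr_ne_zero hc)
  have := g_bound hχ hm hc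
  simp only [norm_mul, Function.comp]
  rw [Complex.norm_cpow_eq_rpow_re_of_pos hN]
  calc _ ≤ ((Nm m) ^ (1/2 : ℝ) * Nm c ^ (1/2 : ℝ)) * Nm c ^ (-s).re := by gcongr
    _ = _ := by
      rw [mul_assoc, ← Real.rpow_add hN]; congr 2; simp; ring

end

section

variable {χ : Eis → Eis → Eis}

lemma tsum_split {f : Eis → ℂ} {S A : Set Eis} {q : Eis} (hq : q ≠ 0)
    (hf : Summable (fun x : S => f x)) (hA : A ⊆ S) (hB : ∀ a ∈ A, q * a ∈ S ∧ q * a ∉ A)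
    (hz : ∀ x ∈ S, x ∉ A → (∀ a ∈ A, x ≠ q * a) → f x = 0) :
    ∑' x : S, f x = ∑' x : A, f x + ∑' x : A, f (q * x) := by
  classical
  set B : Set Eis := (fun a => q * a) '' A with hBdef
  have hinj : Function.Injective (fun a : Eis => q * a) := fun a b h => mul_left_cancel₀ hq h
  have h1 : ∑' x : A, f (q * x) = ∑' x : B, f x := by
    rw [hBdef, tsum_image f hinj.injOn]
  have hBS : B ⊆ S := by rintro _ ⟨a, ha, rfl⟩; exact (hB a ha).1
  have hS : Summable (S.indicator f) := summable_subtype_iff_indicator.1 hf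
  have hAs : Summable (A.indicator f) := by
    have := hS.indicator A
    rwa [Set.indicator_indicator, Set.inter_eq_left.2 hA] at this
  have hBs : Summable (B.indicator f) := by
    have := hS.indicator B
    rwa [Set.indicator_indicator, Set.inter_eq_left.2 hBS] at this
  rw [h1, tsum_subtype, tsum_subtype, tsum_subtype, ← hAs.tsum_add hBs]
  apply tsum_congr
  intro x
  by_cases hxA : x ∈ A
  · have hxB : x ∉ B := by
      rintro ⟨a, ha, rfl⟩
      exact (hB a ha).2 hxA
    rw [Set.indicator_of_mem hxA, Set.indicator_of_notMem hxB, Set.indicator_of_mem (hA hxA), add_zero]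
  · rw [Set.indicator_of_notMem hxA]
    by_cases hxB : x ∈ B
    · rw [Set.indicator_of_mem hxB, Set.indicator_of_mem (hBS hxB), zero_add]
    · rw [Set.indicator_of_notMem hxB, zero_add]
      by_cases hxS : x ∈ S
      · rw [Set.indicator_of_mem hxS]
        exact hz x hxS hxA (fun a ha h => hxB ⟨a, ha, h.symm⟩)
      · rw [Set.indicator_of_notMem hxS]

lemma Nm_cpow_mul (x y : Eis) (w : ℂ) : (Nm (x * y) : ℂ) ^ w = (Nm x : ℂ) ^ w * (Nm y : ℂ) ^ w := by
  rw [Nm_mul, Complex.ofReal_mul, Complex.mul_cpow_ofReal_nonneg (Nm_nonneg _) (Nm_nonneg _)]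

lemma Nm_cpow_pow (x : Eis) (k : ℕ) (w : ℂ) : (Nm (x ^ k) : ℂ) ^ w = ((Nm x : ℂ) ^ w) ^ k := by
  induction k with
  | zero => simp [Nm_one]
  | succ k ih => rw [pow_succ, Nm_cpow_mul, ih, pow_succ]

/-- Summation set of `ψ_α`. -/
def SS (α : Eis) : Set Eis := {c | Pr c ∧ IsCoprime c α}

lemma psi_eq (α m : Eis) (s : ℂ) : ψa χ α m s = ∑' c : SS α, g₃ χ m c * (Nm (c : Eis) : ℂ) ^ (-s) := rfl

lemma psi_step (hχ : IsCubicSymbol χ) {p : Eis} (hp : Prime p) (hpp : Pr p) {α n : Eis} (hα : ¬ p ∣ α)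
    (hn0 : n ≠ 0) (hn : ¬ p ∣ n) {s : ℂ} (hs : 3/2 < s.re) {v : ℕ} (hv : v ≤ 2) :
    ψa χ α (p ^ v * n) s = ψa χ (α * p) (p ^ v * n) s +
      ((Nm p : ℂ) ^ (-s)) ^ (v + 1) * g₃ χ (p ^ v * n) (p ^ (v + 1)) *
        ψa χ (α * p) (p ^ v * n * p ^ (v + 1)) s := by
  have hm0 : p ^ v * n ≠ 0 := mul_ne_zero (pow_ne_zero _ hp.ne_zero) hn0
  have hq0 : p ^ (v + 1) ≠ 0 := pow_ne_zero _ hp.ne_zero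
  have hqP : Pr (p ^ (v + 1)) := Pr_pow hpp _
  have hpα : IsCoprime p α := (hp.coprime_iff_not_dvd).2 hα
  rw [psi_eq, psi_eq, psi_eq]
  rw [tsum_split (f := fun c => g₃ χ (p ^ v * n) c * (Nm c : ℂ) ^ (-s)) (S := SS α) (A := SS (α * p)) (q := p ^ (v + 1)) hq0]
  · congr 1
    rw [← tsum_mul_left]
    apply tsum_congr
    rintro ⟨c, hc, hcα⟩
    have hcp : IsCoprime c (p ^ (v + 1)) := (IsCoprime.of_mul_right_right hcα).pow_right
    simp only
    rw [mul_comm (p ^ (v + 1)) c, g_mul' hχ hc hqP hcp, Nm_cpow_mul, Nm_cpow_pow]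
    ring
  · exact (summable_g hχ hm0 hs).comp_injective (i := fun c : SS α => (⟨c.1, c.2.1⟩ : {c : Eis // Pr c}))
      (fun a b h => Subtype.ext (by simpa using h))
  · rintro c ⟨hc, hcα⟩
    exact ⟨hc, IsCoprime.of_mul_right_left hcα⟩
  · rintro c ⟨hc, hcα⟩
    refine ⟨⟨Pr_mul hqP hc, (hpα.pow_left).mul_left (IsCoprime.of_mul_right_left hcα)⟩, ?_⟩
    rintro ⟨-, h⟩
    have h2 := IsCoprime.of_mul_right_right h
    rw [isCoprime_comm, hp.coprime_iff_not_dvd] at h2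
    exact h2 (dvd_mul_of_dvd_left (dvd_pow_self _ (by omega)) _)
  · rintro x ⟨hx, hxα⟩ hxA hxB
    have hpx : p ∣ x := by
      by_contra h
      apply hxA
      refine ⟨hx, hxα.mul_right ?_⟩
      rw [isCoprime_comm, hp.coprime_iff_not_dvd]; exact h
    have hfin : FiniteMultiplicity p x := FiniteMultiplicity.of_prime_left hp (Pr_ne_zero hx)
    obtain ⟨y, hy1, hy2⟩ := hfin.exists_eq_pow_mul_and_not_dvd
    generalize multiplicity p x = k at hy1
    rcases k with _ | k
    · rw [pow_zero, one_mul] at hy1; rw [hy1] at hpx; exact absurd hpx hy2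
    have hyP : Pr y := by
      refine Pr_of_mul (Pr_pow hpp (k + 1)) ?_
      rw [← hy1]; exact hx
    have hyp : IsCoprime y p := by rw [isCoprime_comm, hp.coprime_iff_not_dvd]; exact hy2
    have hkv : k ≠ v := by
      rintro rfl
      refine hxB y ⟨hyP, IsCoprime.mul_right ?_ hyp⟩ hy1
      rw [hy1] at hxα
      exact IsCoprime.of_mul_left_right hxα
    have hg : g₃ χ (p ^ v * n) (p ^ (k + 1)) = 0 := by
      rcases lt_or_gt_of_ne hkv with h | h
      · obtain ⟨j, rfl⟩ : ∃ j, v = k + (j + 1) := ⟨v - k - 1, by omega⟩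
        have e : p ^ (k + (j + 1)) * n = p ^ k * (p * (p ^ j * n)) := by ring
        rw [e, g_pp hχ hpp]
        have hg0 : g₃ χ (p * (p ^ j * n)) p = 0 := g_dvd hχ hp hpp (dvd_mul_right _ _)
        obtain rfl | rfl : k = 0 ∨ k = 1 := by omega
        · rw [zero_add, gk_one, hg0, mul_zero]
        · rw [gk_two hχ hpp, hg0, map_zero, mul_zero]
      · apply g_pp_zero hχ hpp
        intro hd
        obtain ⟨j, rfl⟩ : ∃ j, k = v + (j + 1) := ⟨k - v - 1, by omega⟩
        rw [pow_add] at hd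
        have := (mul_dvd_mul_iff_left (pow_ne_zero v hp.ne_zero)).1 hd
        exact hn (dvd_trans (dvd_pow_self _ (by omega)) this)
    rw [hy1, mul_comm (p ^ (k + 1)) y, g_mul' hχ hyP (Pr_pow hpp _) hyp.pow_right, hg]
    simp

lemma psi_cube (hχ : IsCubicSymbol χ) {p : Eis} (α m : Eis) (s : ℂ) :
    ψa χ (α * p) (m * p ^ 3) s = ψa χ (α * p) m s := by
  rw [psi_eq, psi_eq]
  apply tsum_congr
  rintro ⟨c, hc, hcα⟩
  have hcp := IsCoprime.of_mul_right_right hcα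
  simp only
  congr 1
  rw [g_scale hχ hc hcp.pow_right, chi_pow_top hχ hc, chi_cube hχ hc hcp]
  simp

/-- Local factor of `Δ`. -/
def DD (p : Eis) (s : ℂ) : ℂ := 1 - (Nm p : ℂ) ^ ((2 : ℂ) - 3 * s)

lemma DD_eq {p : Eis} (hp : p ≠ 0) (s : ℂ) : DD p s = 1 - (Nm p : ℂ) ^ 2 * ((Nm p : ℂ) ^ (-s)) ^ 3 := by
  unfold DD
  have h0 : (Nm p : ℂ) ≠ 0 := by exact_mod_cast (Nm_pos hp).ne'
  have : (2 : ℂ) - 3 * s = ((2 : ℕ) : ℂ) + ((3 : ℕ) : ℂ) * (-s) := by push_cast; ring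
  rw [this, Complex.cpow_add _ _ h0, Complex.cpow_natCast, Complex.cpow_nat_mul]

lemma DD_ne {p : Eis} (hp : Prime p) {s : ℂ} (hs : 3/2 < s.re) : DD p s ≠ 0 := by
  unfold DD
  intro h
  have h1 : (Nm p : ℂ) ^ ((2 : ℂ) - 3 * s) = 1 := by linear_combination -h
  have h2 := congrArg norm h1
  have hN : 1 < Nm p := by
    rw [← NmN_cast]; exact_mod_cast NmN_prime hp
  rw [Complex.norm_cpow_eq_rpow_re_of_pos (by linarith), norm_one] at h2
  have h3 : Nm p ^ ((2 : ℂ) - 3 * s).re < 1 := Real.rpow_lt_one_of_one_lt_of_neg hN (by simp; linarith)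
  linarith

lemma rec_one (hχ : IsCubicSymbol χ) {p : Eis} (hp : Prime p) (hpp : Pr p) {α n : Eis} (hα : ¬ p ∣ α)
    (hn0 : n ≠ 0) (hn : ¬ p ∣ n) {s : ℂ} (hs : 3/2 < s.re) :
    ψa χ α n s = ψa χ (α * p) n s +
    (Nm p : ℂ) ^ (-s) * g₃ χ n p * ψa χ (α * p) (p * n) s := by
  have := psi_step hχ hp hpp hα hn0 hn hs (v := 0) (by norm_num)
  simpa [mul_comm n p] using this

lemma rec_two (hχ : IsCubicSymbol χ) {p : Eis} (hp : Prime p) (hpp : Pr p) {α n : Eis} (hα : ¬ p ∣ α)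
    (hn0 : n ≠ 0) (hn : ¬ p ∣ n) {s : ℂ} (hs : 3/2 < s.re) :
    ψa χ α (p * n) s = ψa χ (α * p) (p * n) s +
    ((Nm p : ℂ) ^ (-s)) ^ 2 * (Nm p * (starRingEnd ℂ) (g₃ χ n p)) * ψa χ (α * p) n s := by
  have := psi_step hχ hp hpp hα hn0 hn hs (v := 1) (by norm_num)
  rw [g_pp hχ hpp, gk_two hχ hpp] at this
  have e : p ^ 1 * n * p ^ (1 + 1) = n * p ^ 3 := by ring
  rw [e, psi_cube hχ] at this
  simpa using this

lemma rec_three (hχ : IsCubicSymbol χ) {p : Eis} (hp : Prime p) (hpp : Pr p) {α n : Eis} (hα : ¬ p ∣ α)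
    (hn0 : n ≠ 0) (hn : ¬ p ∣ n) {s : ℂ} (hs : 3/2 < s.re) :
    ψa χ α (p ^ 2 * n) s = DD p s * ψa χ (α * p) (p ^ 2 * n) s := by
  have := psi_step hχ hp hpp hα hn0 hn hs (v := 2) (by norm_num)
  rw [g_pp hχ hpp, gk_three hχ hp hpp, if_neg hn, psi_cube hχ] at this
  rw [this, DD_eq hp.ne_zero]; ring

lemma rec_A (hχ : IsCubicSymbol χ) {p : Eis} (hp : Prime p) (hpp : Pr p) {α n : Eis} (hα : ¬ p ∣ α)
    (hn0 : n ≠ 0) (hn : ¬ p ∣ n) {s : ℂ} (hs : 3/2 < s.re) :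
    DD p s * ψa χ (α * p) n s = ψa χ α n s -
    (Nm p : ℂ) ^ (-s) * g₃ χ n p * ψa χ α (p * n) s := by
  rw [rec_one hχ hp hpp hα hn0 hn hs, rec_two hχ hp hpp hα hn0 hn hs, DD_eq hp.ne_zero]
  linear_combination ((Nm p : ℂ) ^ (-s)) ^ 3 * Nm p * ψa χ (α * p) n s * g_norm_sq hχ hp hpp hn

lemma rec_B (hχ : IsCubicSymbol χ) {p : Eis} (hp : Prime p) (hpp : Pr p) {α n : Eis} (hα : ¬ p ∣ α)
    (hn0 : n ≠ 0) (hn : ¬ p ∣ n) {s : ℂ} (hs : 3/2 < s.re) :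
    DD p s * ψa χ (α * p) (p * n) s = ψa χ α (p * n) s -
    ((Nm p : ℂ) ^ (-s)) ^ 2 * (Nm p * (starRingEnd ℂ) (g₃ χ n p)) * ψa χ α n s := by
  rw [rec_one hχ hp hpp hα hn0 hn hs, rec_two hχ hp hpp hα hn0 hn hs, DD_eq hp.ne_zero]
  linear_combination ((Nm p : ℂ) ^ (-s)) ^ 3 * Nm p * ψa χ (α * p) (p * n) s * g_norm_sq hχ hp hpp hn

end

section

variable {χ : Eis → Eis → Eis}

/-- Factorizations `a = d f` with `d` primary. -/
def AS (a : Eis) : Set (Eis × Eis) := {t | Pr t.1 ∧ t.1 * t.2 = a}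

lemma AS_one : AS 1 = {(1, 1)} := by
  ext ⟨d, f⟩
  simp only [AS, Set.mem_setOf_eq, Set.mem_singleton_iff, Prod.mk.injEq]
  constructor
  · rintro ⟨h1, h2⟩
    have : d = 1 := Pr_unit (IsUnit.of_mul_eq_one _ h2) h1
    subst this
    exact ⟨rfl, by simpa using h2⟩
  · rintro ⟨rfl, rfl⟩; exact ⟨Pr_one, by simp⟩

lemma AS_prime {p n : Eis} (hp : Prime p) (hpp : Pr p) :
    AS (p * n) = (fun t : Eis × Eis => (t.1, p * t.2)) '' AS n ∪ (fun t : Eis × Eis => (p * t.1, t.2)) '' AS n := by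
  ext ⟨d, f⟩
  constructor
  · rintro ⟨h1, h2⟩
    simp only at h1 h2
    have : p ∣ d * f := by rw [h2]; exact dvd_mul_right _ _
    rcases hp.dvd_or_dvd this with ⟨x, rfl⟩ | ⟨x, rfl⟩
    · refine Or.inr ⟨(x, f), ⟨Pr_of_mul hpp h1, ?_⟩, rfl⟩
      apply mul_left_cancel₀ hp.ne_zero
      rw [← h2]; ring
    · refine Or.inl ⟨(d, x), ⟨h1, ?_⟩, rfl⟩
      apply mul_left_cancel₀ hp.ne_zero
      rw [← h2]; ring
  · rintro (⟨⟨x, y⟩, ⟨h1, h2⟩, h⟩ | ⟨⟨x, y⟩, ⟨h1, h2⟩, h⟩)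
    · simp only [Prod.mk.injEq] at h h1 h2
      obtain ⟨rfl, rfl⟩ := h
      exact ⟨h1, by simp only; rw [← h2]; ring⟩
    · simp only [Prod.mk.injEq] at h h1 h2
      obtain ⟨rfl, rfl⟩ := h
      exact ⟨Pr_mul hpp h1, by simp only; rw [← h2]; ring⟩

lemma AS_finite {a : Eis} (ha : Pr a) : (AS a).Finite := by
  refine primary_induction (P := fun a => (AS a).Finite) ?_ ?_ a ha
  · rw [AS_one]; exact Set.finite_singleton _
  · intro p n hp hpp hn ih
    rw [AS_prime hp hpp]
    exact (ih.image _).union (ih.image _)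

open Classical in
/-- Finset version of `AS`. -/
def AF (a : Eis) : Finset (Eis × Eis) := if h : (AS a).Finite then h.toFinset else ∅

lemma coe_AF {a : Eis} (ha : Pr a) : (AF a : Set (Eis × Eis)) = AS a := by
  unfold AF; rw [dif_pos (AS_finite ha)]; simp

lemma mem_AF {a : Eis} (ha : Pr a) {t : Eis × Eis} : t ∈ AF a ↔ Pr t.1 ∧ t.1 * t.2 = a := by
  rw [← Finset.mem_coe, coe_AF ha]; rfl

lemma sum_AF_one (F : Eis → Eis → ℂ) : ∑ t ∈ AF 1, F t.1 t.2 = F 1 1 := by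
  have : AF 1 = {(1, 1)} := by
    apply Finset.coe_injective
    rw [coe_AF Pr_one, AS_one]; simp
  rw [this, Finset.sum_singleton]

lemma sum_AF_prime {p n : Eis} (hp : Prime p) (hpp : Pr p) (hn : Pr n) (h : ¬ p ∣ n) (F : Eis → Eis → ℂ) :
    ∑ t ∈ AF (p * n), F t.1 t.2 = ∑ t ∈ AF n, F t.1 (p * t.2) + ∑ t ∈ AF n, F (p * t.1) t.2 := by
  classical
  have e : AF (p * n) = (AF n).image (fun t : Eis × Eis => (t.1, p * t.2)) ∪
      (AF n).image (fun t : Eis × Eis => (p * t.1, t.2)) := by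
    apply Finset.coe_injective
    rw [Finset.coe_union, Finset.coe_image, Finset.coe_image, coe_AF hn, coe_AF (Pr_mul hpp hn), AS_prime hp hpp]
  rw [e, Finset.sum_union, Finset.sum_image, Finset.sum_image]
  · rintro ⟨x, y⟩ _ ⟨x', y'⟩ _ h
    simp only [Prod.mk.injEq] at h
    exact Prod.ext (mul_left_cancel₀ hp.ne_zero h.1) h.2
  · rintro ⟨x, y⟩ _ ⟨x', y'⟩ _ h
    simp only [Prod.mk.injEq] at h
    exact Prod.ext h.1 (mul_left_cancel₀ hp.ne_zero h.2)
  · rw [Finset.disjoint_left]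
    intro t h1 h2
    rw [Finset.mem_image] at h1 h2
    obtain ⟨⟨x, y⟩, hx, rfl⟩ := h1
    obtain ⟨⟨x', y'⟩, hx', h3⟩ := h2
    rw [mem_AF hn] at hx
    simp only [Prod.mk.injEq] at h3 hx
    apply h
    rw [← hx.2, ← h3.1]
    exact Dvd.intro _ (by ring : p * (x' * y) = _)

/-- The summand of the main formula. -/
def TT (χ : Eis → Eis → Eis) (μ : Eis → ℤ) (s : ℂ) (d M e : Eis) : ℂ :=
  (μ (d * e) : ℂ) * ((Nm d : ℂ) / (Nm (d ^ 2 * e) : ℂ) ^ s) *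
    (starRingEnd ℂ) (g₃ χ M d) * g₃ χ M e * ψ₀ χ (M * e) s

lemma cpow_s {x : Eis} (s : ℂ) : ((Nm x : ℂ) ^ s)⁻¹ = (Nm x : ℂ) ^ (-s) := (Complex.cpow_neg _ _).symm

lemma TT_d (hχ : IsCubicSymbol χ) {μ : Eis → ℤ} (hμ : IsMoebius μ) (s : ℂ) {p d M e : Eis} (hp : Prime p)
    (hpp : Pr p) (hd : Pr d) (h : ¬ p ∣ d) (he : ¬ p ∣ e) :
    TT χ μ s (p * d) M e =
      - (((Nm p : ℂ) ^ (-s)) ^ 2 * (Nm p * (starRingEnd ℂ) (g₃ χ (d * M) p))) * TT χ μ s d M e := by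
  unfold TT
  have hco : IsCoprime p d := (hp.coprime_iff_not_dvd).2 h
  have hde : ¬ p ∣ d * e := fun hh => (hp.dvd_or_dvd hh).elim h he
  have e1 : p * d * e = p * (d * e) := by ring
  have e2 : (p * d) ^ 2 * e = p ^ 2 * (d ^ 2 * e) := by ring
  rw [e1, hμ.prime_mul _ _ hp hde, e2, Nm_cpow_mul, Nm_cpow_pow, g_mul' hχ hpp hd hco, Nm_mul, ← cpow_s,
    mul_comm d M, map_mul]
  have h1 : (Nm p : ℂ) ^ s ≠ 0 := by
    rw [Complex.cpow_ne_zero_iff]; left; exact_mod_cast (Nm_pos hp.ne_zero).ne'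
  push_cast
  rw [div_eq_mul_inv, div_eq_mul_inv, mul_inv, inv_pow]
  ring

lemma TT_e (hχ : IsCubicSymbol χ) {μ : Eis → ℤ} (hμ : IsMoebius μ) (s : ℂ) {p d M e : Eis} (hp : Prime p)
    (hpp : Pr p) (hd : Pr d) (heP : Pr e) (h : ¬ p ∣ d) (he : ¬ p ∣ e) :
    TT χ μ s d M (p * e) =
      - ((Nm p : ℂ) ^ (-s) * g₃ χ (d * M) p) * TT χ μ s d (M * p) e := by
  unfold TT
  have hco : IsCoprime p d := (hp.coprime_iff_not_dvd).2 h
  have hcoe : IsCoprime p e := (hp.coprime_iff_not_dvd).2 he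
  have hde : ¬ p ∣ d * e := fun hh => (hp.dvd_or_dvd hh).elim h he
  have e1 : d * (p * e) = p * (d * e) := by ring
  have e2 : d ^ 2 * (p * e) = p * (d ^ 2 * e) := by ring
  have e3 : M * (p * e) = M * p * e := by ring
  have e4 : g₃ χ M (p * e) = g₃ χ (M * p) e * g₃ χ M p := by
    rw [mul_comm p e, g_mul' hχ heP hpp hcoe.symm]
  rw [e1, hμ.prime_mul _ _ hp hde, e2, Nm_cpow_mul, e3, e4, ← cpow_s, mul_comm d M,
    g_scale hχ hpp hco M, g_scale hχ hd hco.symm M, map_mul, map_pow, X_conj hχ hd, recip hχ hpp hd hco]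
  have h3 := X_cube hχ hd hco.symm
  have h6 : ((χ d p : Eis) : ℂ) ^ 6 = 1 := by
    have : ((χ d p : Eis) : ℂ) ^ 6 = (((χ d p : Eis) : ℂ) ^ 3) ^ 2 := by ring
    rw [this, h3]; norm_num
  push_cast
  rw [div_eq_mul_inv, div_eq_mul_inv, mul_inv]
  generalize ((χ d p : Eis) : ℂ) = X at h6 ⊢
  generalize ((Nm p : ℂ) ^ s)⁻¹ = z
  generalize ((Nm (d ^ 2 * e) : ℂ) ^ s)⁻¹ = w
  generalize ψ₀ χ (M * p * e) s = P
  generalize g₃ χ (M * p) e = G1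
  generalize g₃ χ M p = G2
  generalize (starRingEnd ℂ) (g₃ χ M d) = G3
  linear_combination (z * G2 * μ (d * e) * Nm d * w * G3 * G1 * P) * h6

lemma Delta_mul {α p : Eis} (hα : Pr α) (hp : Prime p) (hpp : Pr p) (h : ¬ p ∣ α) (s : ℂ) :
    Δprod (α * p) s = DD p s * Δprod α s := by
  unfold Δprod
  have e : {q : Eis | Prime q ∧ (3 : Eis) ∣ (q - 1) ∧ q ∣ α * p} =
      insert p {q : Eis | Prime q ∧ (3 : Eis) ∣ (q - 1) ∧ q ∣ α} := by
    ext q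
    simp only [Set.mem_setOf_eq, Set.mem_insert_iff]
    constructor
    · rintro ⟨h1, h2, h3⟩
      rcases h1.dvd_or_dvd h3 with h4 | h4
      · exact Or.inr ⟨h1, h2, h4⟩
      · left; exact Pr_assoc h2 hpp (h1.associated_of_dvd hp h4)
    · rintro (rfl | ⟨h1, h2, h3⟩)
      · exact ⟨hp, hpp, dvd_mul_left _ _⟩
      · exact ⟨h1, h2, h3.mul_right _⟩
  rw [e, finprod_mem_insert]
  · rfl
  · rintro ⟨-, -, h1⟩; exact h h1
  · refine ((AS_finite hα).image Prod.fst).subset ?_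
    rintro q ⟨h1, h2, ⟨k, rfl⟩⟩
    exact ⟨(q, k), ⟨h2, rfl⟩, rfl⟩

lemma Delta_one (s : ℂ) : Δprod 1 s = 1 := by
  unfold Δprod
  have : {q : Eis | Prime q ∧ (3 : Eis) ∣ (q - 1) ∧ q ∣ 1} = ∅ := by
    ext q
    simp only [Set.mem_setOf_eq, Set.mem_empty_iff_false, iff_false]
    rintro ⟨h1, -, h3⟩
    exact h1.not_unit (isUnit_of_dvd_one h3)
  rw [this, finprod_mem_empty]

lemma Delta_ne (α : Eis) {s : ℂ} (hs : 3/2 < s.re) : Δprod α s ≠ 0 := by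
  unfold Δprod
  refine finprod_mem_induction (p := fun z : ℂ => z ≠ 0) one_ne_zero (fun _ _ => mul_ne_zero) ?_
  rintro q ⟨h1, -, -⟩
  exact DD_ne h1 hs

lemma psi_one (m : Eis) (s : ℂ) : ψa χ 1 m s = ψ₀ χ m s := by
  unfold ψa ψ₀
  exact (Equiv.subtypeEquivRight (fun c : Eis =>
    (and_iff_left isCoprime_one_right : (3 : Eis) ∣ (c - 1) ∧ IsCoprime c 1 ↔ (3 : Eis) ∣ (c - 1)))).tsum_eq
    (fun c : {c : Eis // (3 : Eis) ∣ (c - 1)} => g₃ χ m c.1 * (Nm c.1 : ℂ) ^ (-s))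

/-- The claim, with the double sum over factorizations. -/
def QQ (χ : Eis → Eis → Eis) (μ : Eis → ℤ) (s : ℂ) (a b c : Eis) : Prop :=
  Squarefree (a * b * c) → ∀ r, r ≠ 0 → IsCoprime (a * b * c) r →
    Δprod (a * b * c) s * ψa χ (a * b * c) (a * b ^ 2 * r) s =
      ∑ t ∈ AF a, ∑ u ∈ AF c, TT χ μ s t.1 (t.2 * b ^ 2 * r) u.1

lemma QQ_one (hχ : IsCubicSymbol χ) {μ : Eis → ℤ} (hμ : IsMoebius μ) (s : ℂ) : QQ χ μ s 1 1 1 := by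
  intro _ r _ _
  rw [sum_AF_one (fun d f => ∑ u ∈ AF 1, TT χ μ s d (f * 1 ^ 2 * r) u.1),
    sum_AF_one (fun e _ => TT χ μ s 1 (1 * 1 ^ 2 * r) e)]
  unfold TT
  simp [g_one hχ, Nm_one, psi_one, Delta_one, hμ.isUnit 1 isUnit_one]

lemma sqf_aux {p n : Eis} (hp : Prime p) (h : Squarefree (p * n)) : ¬ p ∣ n ∧ Squarefree n := by
  refine ⟨fun ⟨k, hk⟩ => ?_, h.of_mul_right⟩
  exact hp.not_unit (h p ⟨k, by rw [hk]; ring⟩)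

lemma QQ_b (hχ : IsCubicSymbol χ) {μ : Eis → ℤ} {s : ℂ} (hs : 3/2 < s.re) {a b c p : Eis}
    (ha : Pr a) (hb : Pr b) (hc : Pr c) (hp : Prime p) (hpp : Pr p) (ih : QQ χ μ s a b c) :
    QQ χ μ s a (p * b) c := by
  intro hsf r hr hcop
  have e0 : a * (p * b) * c = p * (a * b * c) := by ring
  rw [e0] at hsf hcop
  obtain ⟨h1, h2⟩ := sqf_aux hp hsf
  have hpr := (hp.coprime_iff_not_dvd).1 hcop.of_mul_left_left
  have hpa : ¬ p ∣ a := fun h => h1 (by rw [mul_assoc]; exact h.mul_right _)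
  have hpb : ¬ p ∣ b := fun h => h1 ((h.mul_left a).mul_right _)
  have hn : ¬ p ∣ a * b ^ 2 * r := by
    intro h
    rcases hp.dvd_or_dvd h with h | h
    · rcases hp.dvd_or_dvd h with h | h
      · exact hpa h
      · exact hpb (hp.dvd_of_dvd_pow h)
    · exact hpr h
  have hn0 : a * b ^ 2 * r ≠ 0 :=
    mul_ne_zero (mul_ne_zero (Pr_ne_zero ha) (pow_ne_zero _ (Pr_ne_zero hb))) hr
  have hα : Pr (a * b * c) := Pr_mul (Pr_mul ha hb) hc
  have key := rec_three hχ hp hpp h1 hn0 hn hs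
  have hcp : IsCoprime (a * b * c) p := ((hp.coprime_iff_not_dvd).2 h1).symm
  have I := ih h2 (p ^ 2 * r) (mul_ne_zero (pow_ne_zero _ hp.ne_zero) hr)
    (IsCoprime.mul_right hcp.pow_right hcop.of_mul_left_right)
  have e1 : a * b ^ 2 * (p ^ 2 * r) = p ^ 2 * (a * b ^ 2 * r) := by ring
  have e2 : a * (p * b) ^ 2 * r = p ^ 2 * (a * b ^ 2 * r) := by ring
  rw [e1, key] at I
  rw [e0, mul_comm p, e2, Delta_mul hα hp hpp h1]
  calc _ = Δprod (a * b * c) s * (DD p s * ψa χ (a * b * c * p) (p ^ 2 * (a * b ^ 2 * r)) s) := by ring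
    _ = _ := by
      rw [I]
      refine Finset.sum_congr rfl (fun t _ => Finset.sum_congr rfl (fun u _ => ?_))
      congr 1; ring

lemma QQ_a (hχ : IsCubicSymbol χ) {μ : Eis → ℤ} (hμ : IsMoebius μ) {s : ℂ} (hs : 3/2 < s.re) {a b c p : Eis}
    (ha : Pr a) (hb : Pr b) (hc : Pr c) (hp : Prime p) (hpp : Pr p) (ih : QQ χ μ s a b c) :
    QQ χ μ s (p * a) b c := by
  intro hsf r hr hcop
  have e0 : p * a * b * c = p * (a * b * c) := by ring
  rw [e0] at hsf hcop
  obtain ⟨h1, h2⟩ := sqf_aux hp hsf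
  have hpr := (hp.coprime_iff_not_dvd).1 hcop.of_mul_left_left
  have hpa : ¬ p ∣ a := fun h => h1 (by rw [mul_assoc]; exact h.mul_right _)
  have hpb : ¬ p ∣ b := fun h => h1 ((h.mul_left a).mul_right _)
  have hpc : ¬ p ∣ c := fun h => h1 (h.mul_left _)
  have hn : ¬ p ∣ a * b ^ 2 * r := by
    intro h
    rcases hp.dvd_or_dvd h with h | h
    · rcases hp.dvd_or_dvd h with h | h
      · exact hpa h
      · exact hpb (hp.dvd_of_dvd_pow h)
    · exact hpr h
  have hn0 : a * b ^ 2 * r ≠ 0 :=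
    mul_ne_zero (mul_ne_zero (Pr_ne_zero ha) (pow_ne_zero _ (Pr_ne_zero hb))) hr
  have hα : Pr (a * b * c) := Pr_mul (Pr_mul ha hb) hc
  have key := rec_B hχ hp hpp h1 hn0 hn hs
  have hcp : IsCoprime (a * b * c) p := ((hp.coprime_iff_not_dvd).2 h1).symm
  have I1 := ih h2 (p * r) (mul_ne_zero hp.ne_zero hr) (IsCoprime.mul_right hcp hcop.of_mul_left_right)
  have I2 := ih h2 r hr hcop.of_mul_left_right
  have e1 : a * b ^ 2 * (p * r) = p * (a * b ^ 2 * r) := by ring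
  have e2 : p * a * b ^ 2 * r = p * (a * b ^ 2 * r) := by ring
  rw [e1] at I1
  rw [e0, mul_comm p (a * b * c), e2, Delta_mul hα hp hpp h1,
    sum_AF_prime hp hpp ha hpa (fun d f => ∑ u ∈ AF c, TT χ μ s d (f * b ^ 2 * r) u.1)]
  calc _ = Δprod (a * b * c) s * (DD p s * ψa χ (a * b * c * p) (p * (a * b ^ 2 * r)) s) := by ring
    _ = Δprod (a * b * c) s * ψa χ (a * b * c) (p * (a * b ^ 2 * r)) s +
      (- (((Nm p : ℂ) ^ (-s)) ^ 2 * (Nm p * (starRingEnd ℂ) (g₃ χ (a * b ^ 2 * r) p)))) *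
      (Δprod (a * b * c) s * ψa χ (a * b * c) (a * b ^ 2 * r) s) := by rw [key]; ring
    _ = _ := by
      rw [I1, I2, Finset.mul_sum]
      congr 1
      · refine Finset.sum_congr rfl (fun t _ => Finset.sum_congr rfl (fun u _ => ?_))
        congr 1; ring
      · refine Finset.sum_congr rfl (fun t ht => ?_)
        rw [Finset.mul_sum]
        refine Finset.sum_congr rfl (fun u hu => ?_)
        rw [mem_AF ha] at ht
        rw [mem_AF hc] at hu
        rw [TT_d hχ hμ s hp hpp ht.1 (fun h => hpa (by rw [← ht.2]; exact h.mul_right _))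
          (fun h => hpc (by rw [← hu.2]; exact h.mul_right _))]
        have : a * b ^ 2 * r = t.1 * (t.2 * b ^ 2 * r) := by rw [← ht.2]; ring
        rw [this]

lemma QQ_c (hχ : IsCubicSymbol χ) {μ : Eis → ℤ} (hμ : IsMoebius μ) {s : ℂ} (hs : 3/2 < s.re) {a b c p : Eis}
    (ha : Pr a) (hb : Pr b) (hc : Pr c) (hp : Prime p) (hpp : Pr p) (ih : QQ χ μ s a b c) :
    QQ χ μ s a b (p * c) := by
  intro hsf r hr hcop
  have e0 : a * b * (p * c) = p * (a * b * c) := by ring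
  rw [e0] at hsf hcop
  obtain ⟨h1, h2⟩ := sqf_aux hp hsf
  have hpr := (hp.coprime_iff_not_dvd).1 hcop.of_mul_left_left
  have hpa : ¬ p ∣ a := fun h => h1 (by rw [mul_assoc]; exact h.mul_right _)
  have hpb : ¬ p ∣ b := fun h => h1 ((h.mul_left a).mul_right _)
  have hpc : ¬ p ∣ c := fun h => h1 (h.mul_left _)
  have hn : ¬ p ∣ a * b ^ 2 * r := by
    intro h
    rcases hp.dvd_or_dvd h with h | h
    · rcases hp.dvd_or_dvd h with h | h
      · exact hpa h
      · exact hpb (hp.dvd_of_dvd_pow h)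
    · exact hpr h
  have hn0 : a * b ^ 2 * r ≠ 0 :=
    mul_ne_zero (mul_ne_zero (Pr_ne_zero ha) (pow_ne_zero _ (Pr_ne_zero hb))) hr
  have hα : Pr (a * b * c) := Pr_mul (Pr_mul ha hb) hc
  have key := rec_A hχ hp hpp h1 hn0 hn hs
  have hcp : IsCoprime (a * b * c) p := ((hp.coprime_iff_not_dvd).2 h1).symm
  have I1 := ih h2 (p * r) (mul_ne_zero hp.ne_zero hr) (IsCoprime.mul_right hcp hcop.of_mul_left_right)
  have I2 := ih h2 r hr hcop.of_mul_left_right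
  have e1 : a * b ^ 2 * (p * r) = p * (a * b ^ 2 * r) := by ring
  rw [e1] at I1
  rw [e0, mul_comm p (a * b * c), Delta_mul hα hp hpp h1]
  calc _ = Δprod (a * b * c) s * (DD p s * ψa χ (a * b * c * p) (a * b ^ 2 * r) s) := by ring
    _ = Δprod (a * b * c) s * ψa χ (a * b * c) (a * b ^ 2 * r) s +
      (- ((Nm p : ℂ) ^ (-s) * g₃ χ (a * b ^ 2 * r) p)) *
      (Δprod (a * b * c) s * ψa χ (a * b * c) (p * (a * b ^ 2 * r)) s) := by rw [key]; ring
    _ = _ := by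
      rw [I1, I2, Finset.mul_sum, ← Finset.sum_add_distrib]
      refine Finset.sum_congr rfl (fun t ht => ?_)
      rw [sum_AF_prime hp hpp hc hpc (fun e _ => TT χ μ s t.1 (t.2 * b ^ 2 * r) e)]
      congr 1
      rw [Finset.mul_sum]
      refine Finset.sum_congr rfl (fun u hu => ?_)
      rw [mem_AF ha] at ht
      rw [mem_AF hc] at hu
      rw [TT_e hχ hμ s hp hpp ht.1 hu.1 (fun h => hpa (by rw [← ht.2]; exact h.mul_right _))
        (fun h => hpc (by rw [← hu.2]; exact h.mul_right _))]
      have : a * b ^ 2 * r = t.1 * (t.2 * b ^ 2 * r) := by rw [← ht.2]; ring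
      have h3 : t.2 * b ^ 2 * (p * r) = t.2 * b ^ 2 * r * p := by ring
      rw [this, h3]

lemma QQ_all (hχ : IsCubicSymbol χ) {μ : Eis → ℤ} (hμ : IsMoebius μ) {s : ℂ} (hs : 3/2 < s.re) {a b c : Eis}
    (ha : Pr a) (hb : Pr b) (hc : Pr c) : QQ χ μ s a b c := by
  refine primary_induction (P := fun c => QQ χ μ s a b c) ?_
    (fun p n hp hpp hn ih => QQ_c hχ hμ hs ha hb hn hp hpp ih) c hc
  refine primary_induction (P := fun a => QQ χ μ s a b 1) ?_
    (fun p n hp hpp hn ih => QQ_a hχ hμ hs hn hb Pr_one hp hpp ih) a ha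
  exact primary_induction (P := fun b => QQ χ μ s 1 b 1) (QQ_one hχ hμ s)
    (fun p n hp hpp hn ih => QQ_b hχ hs Pr_one hn Pr_one hp hpp ih) b hb

lemma final_sum (χ : Eis → Eis → Eis) (μ : Eis → ℤ) (s : ℂ) {a b c r : Eis} (ha : Pr a) (hc : Pr c) :
    (∑ᶠ t ∈ {t : Eis × Eis × Eis | (3 : Eis) ∣ (t.1 - 1) ∧ (3 : Eis) ∣ (t.2.1 - 1) ∧
            t.1 ∣ a ∧ t.2.1 ∣ c ∧ t.1 * t.2.2 = a * b ^ 2 * r},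
          (μ (t.1 * t.2.1) : ℂ) * ((Nm t.1 : ℂ) / (Nm (t.1 ^ 2 * t.2.1) : ℂ) ^ s) *
            (starRingEnd ℂ) (g₃ χ t.2.2 t.1) * g₃ χ t.2.2 t.2.1 *
            ψ₀ χ (t.2.2 * t.2.1) s) =
    ∑ t ∈ AF a, ∑ u ∈ AF c, TT χ μ s t.1 (t.2 * b ^ 2 * r) u.1 := by
  classical
  have hset : {t : Eis × Eis × Eis | (3 : Eis) ∣ (t.1 - 1) ∧ (3 : Eis) ∣ (t.2.1 - 1) ∧
            t.1 ∣ a ∧ t.2.1 ∣ c ∧ t.1 * t.2.2 = a * b ^ 2 * r} =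
      (fun x : (Eis × Eis) × (Eis × Eis) => (x.1.1, x.2.1, x.1.2 * b ^ 2 * r)) '' ((AF a ×ˢ AF c : Finset _) : Set _) := by
    ext ⟨d, e, f⟩
    constructor
    · rintro ⟨h1, h2, ⟨k, rfl⟩, ⟨l, rfl⟩, h5⟩
      simp only at h1 h2 h5
      refine ⟨((d, k), (e, l)), ?_, ?_⟩
      · rw [Finset.mem_coe, Finset.mem_product, mem_AF ha, mem_AF hc]
        exact ⟨⟨h1, rfl⟩, ⟨h2, rfl⟩⟩
      · simp only [Prod.mk.injEq, true_and]
        apply mul_left_cancel₀ (Pr_ne_zero h1)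
        rw [h5]; ring
    · rintro ⟨⟨⟨d', k⟩, ⟨e', l⟩⟩, h1, h2⟩
      rw [Finset.mem_coe, Finset.mem_product, mem_AF ha, mem_AF hc] at h1
      simp only [Prod.mk.injEq] at h1 h2
      obtain ⟨rfl, rfl, rfl⟩ := h2
      refine ⟨h1.1.1, h1.2.1, ⟨k, h1.1.2.symm⟩, ⟨l, h1.2.2.symm⟩, ?_⟩
      simp only
      rw [← h1.1.2]; ring
  rw [hset, finsum_mem_image, finsum_mem_coe_finset, Finset.sum_product]
  · rfl
  · rintro ⟨⟨d, k⟩, ⟨e, l⟩⟩ h1 ⟨⟨d', k'⟩, ⟨e', l'⟩⟩ h2 h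
    rw [Finset.mem_coe, Finset.mem_product, mem_AF ha, mem_AF hc] at h1 h2
    simp only [Prod.mk.injEq] at h1 h2 h
    obtain ⟨rfl, rfl, -⟩ := h
    have q1 : k = k' := mul_left_cancel₀ (Pr_ne_zero h1.1.1) (h1.1.2.trans h2.1.2.symm)
    have q2 : l = l' := mul_left_cancel₀ (Pr_ne_zero h1.2.1) (h1.2.2.trans h2.2.2.symm)
    rw [q1, q2]

lemma main_thm
    (χ : Eis → Eis → Eis) (hχ : IsCubicSymbol χ)
    (μ : Eis → ℤ) (hμ : IsMoebius μ)
    (s : ℂ) (hs : 3/2 < s.re)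
    (a b c r : Eis) (hr0 : r ≠ 0)
    (ha : (3 : Eis) ∣ (a - 1)) (hb : (3 : Eis) ∣ (b - 1)) (hc : (3 : Eis) ∣ (c - 1))
    (hsf : Squarefree (a * b * c)) (hcop : IsCoprime (a * b * c) r) :
    ψa χ (a * b * c) (a * b ^ 2 * r) s =
      (Δprod (a * b * c) s)⁻¹ *
        ∑ᶠ t ∈ {t : Eis × Eis × Eis | (3 : Eis) ∣ (t.1 - 1) ∧ (3 : Eis) ∣ (t.2.1 - 1) ∧
            t.1 ∣ a ∧ t.2.1 ∣ c ∧ t.1 * t.2.2 = a * b ^ 2 * r},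
          (μ (t.1 * t.2.1) : ℂ) * ((Nm t.1 : ℂ) / (Nm (t.1 ^ 2 * t.2.1) : ℂ) ^ s) *
            (starRingEnd ℂ) (g₃ χ t.2.2 t.1) * g₃ χ t.2.2 t.2.1 *
            ψ₀ χ (t.2.2 * t.2.1) s := by
  rw [final_sum χ μ s ha hc, ← QQ_all hχ hμ hs ha hb hc hsf r hr0 hcop, ← mul_assoc,
    inv_mul_cancel₀ (Delta_ne _ hs), one_mul]

end

/-- Corollary 6.2, removal of coprimality for cube-free twists:
for `Re(s) > 3/2`, `abc` squarefree `≡ 1 (mod 3)` and `(abc, r) = 1`,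
`ψ_{abc}(ab²r, s) = Δ_{abc}(s)⁻¹ ∑_{d ∣ a} ∑_{e ∣ c} μ(de) (N(d)/N(d²e)^s)
conj(g₃(ab²r/d, d)) g₃(ab²r/d, e) ψ(ab²er/d, s)`.  The inner sum is written over
triples `(d, e, f)` with `d·f = ab²r` (so that `f = ab²r/d`). -/
theorem psi_remove_coprimality_cubefree
    (χ : Eis → Eis → Eis) (hχ : IsCubicSymbol χ)
    (μ : Eis → ℤ) (hμ : IsMoebius μ)
    (s : ℂ) (hs : 3/2 < s.re)
    (a b c r : Eis) (ha0 : a ≠ 0) (hb0 : b ≠ 0) (hc0 : c ≠ 0) (hr0 : r ≠ 0)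
    (ha : (3 : Eis) ∣ (a - 1)) (hb : (3 : Eis) ∣ (b - 1)) (hc : (3 : Eis) ∣ (c - 1))
    (hsf : Squarefree (a * b * c)) (hcop : IsCoprime (a * b * c) r) :
    ψa χ (a * b * c) (a * b ^ 2 * r) s =
      (Δprod (a * b * c) s)⁻¹ *
        ∑ᶠ t ∈ {t : Eis × Eis × Eis | (3 : Eis) ∣ (t.1 - 1) ∧ (3 : Eis) ∣ (t.2.1 - 1) ∧
            t.1 ∣ a ∧ t.2.1 ∣ c ∧ t.1 * t.2.2 = a * b ^ 2 * r},
          (μ (t.1 * t.2.1) : ℂ) * ((Nm t.1 : ℂ) / (Nm (t.1 ^ 2 * t.2.1) : ℂ) ^ s) *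
            (starRingEnd ℂ) (g₃ χ t.2.2 t.1) * g₃ χ t.2.2 t.2.1 *
            ψ₀ χ (t.2.2 * t.2.1) s := by
  exact main_thm χ hχ μ hμ s hs a b c r hr0 ha hb hc hsf hcop

end CubicPaper
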